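/- Let q be a prime power of characteristic p, let d divide q-1, and let 0 < r ≤ p. Let M be the number of elements ξ of F_q such that ξ, ξ+1, ..., ξ+r-1 are all nonzero d-th powers in F_q, and let M_0 be the number of ξ in F_q such that ξ, ξ+1, ..., ξ+r-1 include 0 and are all d-th powers in F_q. Then |M + (M_0 + 1)/d - (q+1)/d^r| ≤ (r - 1 - (r+1)/d + 2/d^r)·√q. -/

import Mathlib

section

open Polynomial

theorem kummer_eq_zero_of_aeval_eq_zero {K E : Type*} [Field K] [Field E] [Algebra K E]
    [IsAlgClosed E] {D : ℕ} (hD : 0 < D) {ζ : K} (hζ : IsPrimitiveRoot ζ D) {z : E} (hz : z ≠ 0)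
    {a : K} (hza : z ^ D = algebraMap K E a)
    (h : ∀ t, 0 < t → t < D → ∀ b, z ^ t ≠ algebraMap K E b)
    {P : K[X]} (hP : P.natDegree < D) (h0 : aeval z P = 0) : P = 0 := by
  by_contra hP0
  have hint : IsIntegral K z := ⟨X ^ D - C a, monic_X_pow_sub_C a hD.ne', by simp [hza]⟩
  have hn : (minpoly K z).natDegree < D :=
    (natDegree_le_natDegree (minpoly.degree_le_of_ne_zero K z hP0 h0)).trans_lt hP
  have hζE : IsPrimitiveRoot (algebraMap K E ζ) D := hζ.map_of_injective (algebraMap K E).injective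
  have hdvd : minpoly K z ∣ X ^ D - C a := minpoly.dvd K z (by simp [hza])
  have : NeZero D := ⟨hD.ne'⟩
  have key : ∀ s : Multiset E, (∀ w ∈ s, w ^ D = z ^ D) →
      ∃ b : K, b ≠ 0 ∧ s.prod = z ^ s.card * algebraMap K E b := by
    intro s
    induction s using Multiset.induction_on with
    | empty => intro _; exact ⟨1, one_ne_zero, by simp⟩
    | cons w s ih =>
      intro hs
      obtain ⟨b, hb, e⟩ := ih fun w hw => hs w (Multiset.mem_cons_of_mem hw)
      have hw := hs w (Multiset.mem_cons_self _ _)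
      obtain ⟨i, -, hi⟩ := hζE.eq_pow_of_pow_eq_one (ξ := w / z) (by
        rw [div_pow, hw, div_self (pow_ne_zero _ hz)])
      refine ⟨ζ ^ i * b, mul_ne_zero (pow_ne_zero _ (hζ.ne_zero hD.ne')) hb, ?_⟩
      have : w = z * algebraMap K E ζ ^ i := by rw [hi]; field_simp
      rw [Multiset.prod_cons, e, this, Multiset.card_cons, map_mul, map_pow]
      ring
  obtain ⟨b, hb, e⟩ := key ((minpoly K z).map (algebraMap K E)).roots (by
    intro w hw
    have hw' : aeval w (minpoly K z) = 0 := by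
      have := isRoot_of_mem_roots hw
      simpa [IsRoot, eval_map_algebraMap] using this
    obtain ⟨g, hg⟩ := hdvd
    have : aeval w (X ^ D - C a) = 0 := by rw [hg, map_mul, hw', zero_mul]
    rw [hza]
    simpa [sub_eq_zero] using this)
  have hsp := IsAlgClosed.splits ((minpoly K z).map (algebraMap K E))
  have hmon : ((minpoly K z).map (algebraMap K E)).Monic := (minpoly.monic hint).map _
  have hc := hsp.coeff_zero_eq_prod_roots_of_monic hmon
  have hcard := hsp.natDegree_eq_card_roots
  rw [e, ← hcard, natDegree_map, coeff_map] at hc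
  refine h _ (minpoly.natDegree_pos hint) hn ((-1) ^ (minpoly K z).natDegree *
    (minpoly K z).coeff 0 * b⁻¹) ?_
  have hbE : algebraMap K E b ≠ 0 := by simpa using hb
  rw [map_mul, map_mul, hc, map_inv₀, map_pow, map_neg, map_one, ← mul_assoc, ← mul_assoc, ← mul_pow]
  simp
  field_simp

theorem pow_ne_algebraMap_of_forall_prime {K E : Type*} [Field K] [Field E] [Algebra K E]
    {D : ℕ} {z : E} (hz : z ≠ 0)
    {a : K} (hza : z ^ D = algebraMap K E a)
    (h : ∀ s, s.Prime → s ∣ D → ∀ b, b ^ s ≠ a) (t : ℕ) (ht : 0 < t) (htD : t < D) (b : K) :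
    z ^ t ≠ algebraMap K E b := by
  intro hb
  have hg : z ^ (t.gcd D) ∈ (algebraMap K E).fieldRange := by
    rw [← zpow_natCast, Nat.gcd_eq_gcd_ab, zpow_add₀ hz, zpow_mul, zpow_mul, zpow_natCast,
      zpow_natCast]
    have h1 : z ^ t ∈ (algebraMap K E).fieldRange := ⟨b, hb.symm⟩
    have h2 : z ^ D ∈ (algebraMap K E).fieldRange := ⟨a, hza.symm⟩
    exact mul_mem (zpow_mem h1 _) (zpow_mem h2 _)
  obtain ⟨κ, hκ⟩ := hg
  obtain ⟨s, hs⟩ := Nat.gcd_dvd_right t D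
  have hs1 : s ≠ 1 := by
    rintro rfl
    have := Nat.le_of_dvd ht (Nat.gcd_dvd_left t D)
    rw [mul_one] at hs
    omega
  obtain ⟨l, hl, m, rfl⟩ := Nat.exists_prime_and_dvd hs1
  refine h l hl ((Dvd.intro m rfl).trans (Dvd.intro_left _ hs.symm)) (κ ^ m) ?_
  apply (algebraMap K E).injective
  rw [map_pow, map_pow, hκ, ← hza, ← pow_mul, ← pow_mul, mul_comm m l, ← hs]

theorem eq_zero_of_eval₂_expand_eq_zero {k : Type*} [CommRing k] {Q : ℕ} {G : k[X][X]}
    (hG : G.natDegree < Q) (h : eval₂ (expand k Q : k[X] →+* k[X]) X G = 0) : G = 0 := by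
  have hQ : 0 < Q := by omega
  ext n j
  by_cases hn : Q ≤ n
  · rw [coeff_eq_zero_of_natDegree_lt (hG.trans_le hn)]; simp
  have := congrArg (fun p => p.coeff (j * Q + n)) h
  rw [eval₂_eq_sum_range' _ hG] at this
  simp only [finsetSum_coeff, coeff_mul_X_pow', coeff_zero] at this
  rw [Finset.sum_eq_single n] at this
  · simpa [coeff_expand hQ, hQ] using this
  · intro i hi hin
    rw [Finset.mem_range] at hi
    split_ifs with hle
    · rw [RingHom.coe_coe, coeff_expand hQ, if_neg]
      rintro ⟨c, hc⟩
      apply hin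
      have h1 : j * Q + n = Q * c + i := by omega
      have := congrArg (· % Q) h1
      simp only [Nat.mul_add_mod_self_right, Nat.mul_add_mod_self_left] at this
      rwa [Nat.mod_eq_of_lt hi, Nat.mod_eq_of_lt (by omega), eq_comm] at this
    · rfl
  · intro hn'
    simp at hn'
    omega

theorem dvd_rootMultiplicity_of_mul_pow_eq {k : Type*} [Field k] {f : k[X]} (hf : f.Monic)
    {s : ℕ} {u v : k[X][X]} (hv : v ≠ 0) (h : C f * v ^ s = f.map C * u ^ s) (α : k) :
    s ∣ f.rootMultiplicity α := by
  have hf0 := hf.ne_zero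
  have hπ : Prime (C (X - C α) : k[X][X]) := prime_C_iff.2 (prime_X_sub_C α)
  have hCf : (C f : k[X][X]) ≠ 0 := C_ne_zero.2 hf0
  have hL : C f * v ^ s ≠ 0 := mul_ne_zero hCf (pow_ne_zero _ hv)
  have hR : f.map C * u ^ s ≠ 0 := h ▸ hL
  have hπf : ¬ (C (X - C α) : k[X][X]) ∣ f.map C := by
    rw [C_dvd_iff_dvd_coeff]
    intro hd
    have := hd f.natDegree
    rw [coeff_map, hf.coeff_natDegree, map_one] at this
    exact (prime_X_sub_C α).not_isUnit (isUnit_of_dvd_one this)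
  have fin : ∀ w : k[X][X], w ≠ 0 → FiniteMultiplicity (C (X - C α) : k[X][X]) w := fun w hw =>
    FiniteMultiplicity.of_prime_left hπ hw
  have hm := congrArg (multiplicity (C (X - C α) : k[X][X])) h
  have hs : s = 0 ∨ u ≠ 0 := by
    by_contra! hh
    exact hR (by rw [hh.2, zero_pow hh.1, mul_zero])
  have hmf : multiplicity (C (X - C α) : k[X][X]) (C f) = f.rootMultiplicity α := by
    refine multiplicity_eq_of_dvd_of_not_dvd ?_ ?_
    · have := map_dvd (C : k[X] →+* k[X][X]) (pow_rootMultiplicity_dvd f α)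
      rwa [map_pow] at this
    · intro hd
      rw [← map_pow, C_dvd_iff_dvd_coeff] at hd
      have := hd 0
      rw [coeff_C_zero, ← le_rootMultiplicity_iff hf0] at this
      omega
  rcases hs with rfl | hu
  · simp only [pow_zero, mul_one] at h
    rw [← hmf, h, multiplicity_eq_zero.2 hπf]
  · rw [multiplicity_mul hπ (fin _ hL), multiplicity_mul hπ (fin _ hR), hmf,
      (fin v hv).multiplicity_pow hπ, (fin u hu).multiplicity_pow hπ,
      multiplicity_eq_zero.2 hπf, zero_add] at hm
    exact (Nat.dvd_add_left (Dvd.intro _ rfl)).1 (hm ▸ Dvd.intro _ rfl)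

theorem exists_isPrimitiveRoot_of_dvd_card_sub_one (k : Type*) [Field k] [Fintype k] {D : ℕ}
    (hdvd : D ∣ Fintype.card k - 1) : ∃ ζ : k, IsPrimitiveRoot ζ D := by
  obtain ⟨g, hg⟩ := IsCyclic.exists_ofOrder_eq_natCard (α := kˣ)
  obtain ⟨c, hc⟩ := hdvd
  rw [Nat.card_units, Nat.card_eq_fintype_card, hc] at hg
  have h1 : 0 < Fintype.card k - 1 := Nat.sub_pos_of_lt Fintype.one_lt_card
  exact ⟨_, (IsPrimitiveRoot.coe_units_iff.2 ((IsPrimitiveRoot.orderOf g).pow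
    (hg ▸ hc ▸ h1) (hg.trans (mul_comm _ _))))⟩

theorem Fin.sum_sub_pow_mul {R : Type*} [CommRing R] {D : ℕ} (F G g : R) (hFG : G = F * g ^ D)
    (c : Fin D → R) (b : Fin D) :
    ∑ a : Fin D, g ^ (a : ℕ) * ((if b ≤ a then F else G) * c (a - b)) =
      F * g ^ (b : ℕ) * ∑ i : Fin D, c i * g ^ (i : ℕ) := by
  have : NeZero D := ⟨by have := b.2; omega⟩
  rw [Finset.mul_sum, ← Equiv.sum_comp (Equiv.subRight b)
    (fun i => F * g ^ (b : ℕ) * (c i * g ^ (i : ℕ)))]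
  refine Finset.sum_congr rfl fun a _ => ?_
  simp only [Equiv.subRight_apply]
  split_ifs with hba
  · rw [Fin.sub_val_of_le hba]
    have : g ^ (a : ℕ) = g ^ (b : ℕ) * g ^ ((a : ℕ) - b) := by
      rw [← pow_add]; congr 1; have : (b : ℕ) ≤ a := hba; omega
    rw [this]; ring
  · have h1 : ((a - b : Fin D) : ℕ) = D + a - b := by
      exact Fin.coe_sub_iff_lt.2 (not_le.1 hba)
    have : g ^ D * g ^ (a : ℕ) = g ^ (b : ℕ) * g ^ ((a - b : Fin D) : ℕ) := by
      rw [← pow_add, ← pow_add]; congr 1; rw [h1]; have := b.2; omega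
    rw [hFG]
    linear_combination F * c (a - b) * this

theorem Fin.sum_mul_pow_mul_sum_mul_pow {R : Type*} [CommRing R] {D : ℕ} (F G g : R)
    (hFG : G = F * g ^ D) (c v : Fin D → R)
    (h : ∀ a, ∑ b, (if b ≤ a then F else G) * c (a - b) * v b = 0) :
    F * ((∑ i : Fin D, c i * g ^ (i : ℕ)) * ∑ i : Fin D, v i * g ^ (i : ℕ)) = 0 := by
  have : ∑ b, v b * ∑ a : Fin D, g ^ (a : ℕ) * ((if b ≤ a then F else G) * c (a - b)) = 0 := by
    simp_rw [Finset.mul_sum]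
    rw [Finset.sum_comm]
    refine Finset.sum_eq_zero fun a _ => ?_
    rw [← mul_zero (g ^ (a : ℕ)), ← h a, Finset.mul_sum]
    exact Finset.sum_congr rfl fun b _ => by ring
  simp_rw [Fin.sum_sub_pow_mul F G g hFG c] at this
  rw [← this, Finset.mul_sum, Finset.mul_sum]
  exact Finset.sum_congr rfl fun b _ => by ring

theorem eq_zero_of_sum_mul_pow_eq_zero {K S E : Type*} [Field K] [CommRing S] [Field E]
    [Algebra S K] [Algebra K E] (hinj : Function.Injective (algebraMap S K))
    {D : ℕ} (hD : 0 < D) {z : E} (h : ∀ P : K[X], P.natDegree < D → aeval z P = 0 → P = 0)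
    (c : Fin D → S)
    (hc : ∑ i : Fin D, algebraMap K E (algebraMap S K (c i)) * z ^ (i : ℕ) = 0) : c = 0 := by
  have := h (∑ i : Fin D, C (algebraMap S K (c i)) * X ^ (i : ℕ)) (by
    refine (natDegree_sum_le_of_forall_le (n := D - 1) _ _ fun i _ => ?_).trans_lt (by omega)
    exact (natDegree_C_mul_X_pow_le _ _).trans (by have := i.2; omega)) (by simpa using hc)
  funext i
  have := congrArg (fun p => coeff p i) this
  simp only [finsetSum_coeff, coeff_C_mul, coeff_X_pow, coeff_zero] at this
  rw [Finset.sum_eq_single i] at this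
  · apply hinj; simpa using this
  · intro j _ hj
    have : (i : ℕ) ≠ j := fun e => hj (Fin.ext e.symm)
    simp [this]
  · simp

theorem stepanov_linearIndependent {k : Type*} [Field k] [Fintype k] {D : ℕ} (hD : 0 < D)
    (hdvd : D ∣ Fintype.card k - 1) {f : k[X]} (hf : f.Monic)
    (H : ∀ s, s.Prime → s ∣ D → ∃ α, ¬ s ∣ f.rootMultiplicity α) {B J : ℕ}
    (hB : D * (B + f.natDegree) < Fintype.card k) {r : Fin D → Fin J → k[X]}
    (hr : ∀ i j, (r i j).natDegree ≤ B)
    (h : ∑ i, (∑ j, r i j * X ^ (Fintype.card k * (j : ℕ))) *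
      (f ^ ((Fintype.card k - 1) / D)) ^ (i : ℕ) = 0) : r = 0 := by
  set Q := Fintype.card k with hQ
  have hQ1 : 1 < Q := Fintype.one_lt_card
  set c := (Q - 1) / D with hc
  have hcD : c * D = Q - 1 := Nat.div_mul_cancel hdvd
  have : NeZero D := ⟨hD.ne'⟩
  let rr : Fin D → k[X][X] := fun i => ∑ j, (r i j).map C * C (X ^ (j : ℕ))
  have hrr : ∀ i, (rr i).natDegree ≤ B := fun i => by
    refine natDegree_sum_le_of_forall_le _ _ fun j _ => ?_
    refine (natDegree_mul_C_le _ _).trans (natDegree_map_le.trans (hr i j))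
  suffices hrr0 : rr = 0 by
    funext i j
    ext n
    have := congrArg (fun p => (p.coeff n).coeff (j : ℕ)) (congrFun hrr0 i)
    simp only [rr, finsetSum_coeff, coeff_mul_C, coeff_map, coeff_C_mul, coeff_X_pow, Pi.zero_apply,
      coeff_zero] at this
    rw [Finset.sum_eq_single j] at this
    · simpa using this
    · intro j' _ hj'
      have : (j : ℕ) ≠ j' := fun e => hj' (Fin.ext e.symm)
      simp [this]
    · simp
  let ev : k[X][X] →+* k[X] := eval₂RingHom (expand k Q : k[X] →+* k[X]) X
  have ev_map : ∀ p : k[X], ev (p.map C) = p := fun p => by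
    have : ((expand k Q : k[X] →ₐ[k] k[X]) : k[X] →+* k[X]).comp C = C := by
      ext x; simp
    simp only [ev, coe_eval₂RingHom, eval₂_map, this, eval₂_C_X]
  have ev_C : ∀ p : k[X], ev (C p) = p ^ Q := fun p => by
    simp [ev, FiniteField.expand_card, hQ]
  have ev_rr : ∀ i, ev (rr i) = ∑ j, r i j * X ^ (Q * (j : ℕ)) := fun i => by
    simp only [rr, map_sum, map_mul, ev_map, ev_C]
    exact Finset.sum_congr rfl fun j _ => by rw [← pow_mul, mul_comm Q]
  obtain ⟨M, hM⟩ : ∃ M : Matrix (Fin D) (Fin D) k[X][X], ∀ a b, M a b =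
    (if b ≤ a then f.map C else C f) * rr (a - b) := ⟨fun _ _ => _, fun _ _ => rfl⟩
  have hMdeg : ∀ a b, (M a b).natDegree ≤ B + f.natDegree := fun a b => by
    rw [hM]
    refine natDegree_mul_le.trans ?_
    have : (if b ≤ a then f.map C else C f : k[X][X]).natDegree ≤ f.natDegree := by
      split_ifs
      · exact natDegree_map_le
      · simp
    have := hrr (a - b)
    omega
  have hdetdeg : M.det.natDegree < Q := by
    refine lt_of_le_of_lt ?_ hB
    rw [Matrix.det_apply]
    refine natDegree_sum_le_of_forall_le _ _ fun σ _ => ?_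
    refine (natDegree_smul_le _ _).trans ((natDegree_prod_le _ _).trans ?_)
    refine (Finset.sum_le_card_nsmul _ _ _ fun i _ => hMdeg (σ i) i).trans ?_
    simp
  have hevdet : ev M.det = 0 := by
    rw [RingHom.map_det, ← Matrix.exists_vecMul_eq_zero_iff]
    refine ⟨fun a => (f ^ c) ^ (a : ℕ), fun h0 => ?_, ?_⟩
    · have := congrFun h0 0
      simp at this
    · funext b
      simp only [Matrix.vecMul, dotProduct, RingHom.mapMatrix_apply, Matrix.map_apply, hM, map_mul,
        apply_ite ev, ev_map, ev_C, ev_rr, Pi.zero_apply]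
      have hFG : f ^ Q = f * (f ^ c) ^ D := by
        rw [← pow_mul, hcD, ← pow_succ', Nat.sub_add_cancel hQ1.le]
      rw [Fin.sum_sub_pow_mul f (f ^ Q) (f ^ c) hFG
        (fun i => ∑ j, r i j * X ^ (Q * (j : ℕ))) b, h, mul_zero]
  have hdet : M.det = 0 := eq_zero_of_eval₂_expand_eq_zero hdetdeg hevdet
  obtain ⟨v, hv, hMv⟩ := Matrix.exists_mulVec_eq_zero_iff.2 hdet
  let K := FractionRing k[X][X]
  let E := AlgebraicClosure K
  have hinj : Function.Injective (algebraMap k[X][X] K) := IsFractionRing.injective _ _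
  have hF0 : algebraMap k[X][X] K (f.map C) ≠ 0 := by
    rw [Ne, map_eq_zero_iff _ hinj]; exact (hf.map _).ne_zero
  have hG0 : algebraMap k[X][X] K (C f) ≠ 0 := by
    rw [Ne, map_eq_zero_iff _ hinj]; exact C_ne_zero.2 hf.ne_zero
  obtain ⟨z, hz⟩ := IsAlgClosed.exists_pow_nat_eq (algebraMap K E
    (algebraMap k[X][X] K (C f) / algebraMap k[X][X] K (f.map C))) hD
  have hz0 : z ≠ 0 := by
    rintro rfl
    rw [zero_pow hD.ne', eq_comm, map_eq_zero_iff _ (algebraMap K E).injective] at hz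
    exact div_ne_zero hG0 hF0 hz
  obtain ⟨ζ, hζ⟩ := exists_isPrimitiveRoot_of_dvd_card_sub_one k hdvd
  have hζK : IsPrimitiveRoot (algebraMap k[X][X] K (C (C ζ))) D :=
    hζ.map_of_injective (f := ((algebraMap k[X][X] K).comp (C.comp C)))
      (hinj.comp (C_injective.comp C_injective))
  have hnp : ∀ s, s.Prime → s ∣ D → ∀ b : K, b ^ s ≠
      algebraMap k[X][X] K (C f) / algebraMap k[X][X] K (f.map C) := by
    intro s hs hsD b hb
    obtain ⟨α, hα⟩ := H s hs hsD
    obtain ⟨u, v, hv, rfl⟩ := IsFractionRing.div_surjective (A := k[X][X]) b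
    have hv0 := nonZeroDivisors.ne_zero hv
    have hv0' : algebraMap k[X][X] K v ≠ 0 := by rwa [Ne, map_eq_zero_iff _ hinj]
    refine hα (dvd_rootMultiplicity_of_mul_pow_eq hf hv0 (u := u) ?_ α)
    apply hinj
    rw [div_pow, div_eq_div_iff (pow_ne_zero _ hv0') hF0] at hb
    simp only [map_mul, map_pow]
    rw [← hb, mul_comm]
  have hker : ∀ P : K[X], P.natDegree < D → aeval z P = 0 → P = 0 := fun P hP h0 =>
    kummer_eq_zero_of_aeval_eq_zero hD hζK hz0 hz
      (pow_ne_algebraMap_of_forall_prime hz0 hz hnp) hP h0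
  have hprod := Fin.sum_mul_pow_mul_sum_mul_pow
    (algebraMap K E (algebraMap k[X][X] K (f.map C)))
    (algebraMap K E (algebraMap k[X][X] K (C f))) z
    (by rw [hz, ← map_mul, mul_div_cancel₀ _ hF0])
    (fun i => algebraMap K E (algebraMap k[X][X] K (rr i)))
    (fun i => algebraMap K E (algebraMap k[X][X] K (v i))) (fun a => by
      have := congrArg (fun t => algebraMap K E (algebraMap k[X][X] K t)) (congrFun hMv a)
      simpa only [Matrix.mulVec, dotProduct, hM, map_sum, map_mul, apply_ite (algebraMap k[X][X] K),
        apply_ite (algebraMap K E), Pi.zero_apply, map_zero] using this)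
  have hF0E : algebraMap K E (algebraMap k[X][X] K (f.map C)) ≠ 0 := by
    rwa [Ne, map_eq_zero_iff _ (algebraMap K E).injective]
  rcases mul_eq_zero.1 ((mul_eq_zero.1 hprod).resolve_left hF0E) with h1 | h1
  · exact eq_zero_of_sum_mul_pow_eq_zero hinj hD hker rr h1
  · exact absurd (eq_zero_of_sum_mul_pow_eq_zero hinj hD hker v h1) hv

theorem exists_ne_zero_sum_mul_aeval_eq_zero {k A ι : Type*} [Field k] [CommRing A] [Algebra k A]
    [Module.Finite k A] [Fintype ι] (V : ι → A[X]) (y : A[X]) {B N : ℕ}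
    (hy : y.natDegree ≤ 1)
    (hV : ∀ i, (V i).natDegree + B < N)
    (hlt : Module.finrank k A * N < Fintype.card ι * (B + 1)) :
    ∃ r : ι → k[X], r ≠ 0 ∧ (∀ i, (r i).natDegree ≤ B) ∧ ∑ i, V i * aeval y (r i) = 0 := by
  classical
  let Ψ : (ι → degreeLT k (B + 1)) →ₗ[k] A[X] := ∑ i, LinearMap.mulLeft k (V i) ∘ₗ
    (aeval y : k[X] →ₐ[k] A[X]).toLinearMap ∘ₗ (degreeLT k (B + 1)).subtype ∘ₗ LinearMap.proj i
  let Φ : (ι → degreeLT k (B + 1)) →ₗ[k] (Fin N → A) :=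
    LinearMap.pi fun n => ((lcoeff A n).restrictScalars k) ∘ₗ Ψ
  have hΨ : ∀ r, Ψ r = ∑ i, V i * aeval y (r i : k[X]) := fun r => by
    simp [Ψ]
  have e := degreeLTEquiv k (B + 1)
  have : Module.Finite k (degreeLT k (B + 1)) := Module.Finite.equiv e.symm
  have hker : LinearMap.ker Φ ≠ ⊥ := by
    apply LinearMap.ker_ne_bot_of_finrank_lt
    rw [Module.finrank_pi_fintype, Module.finrank_pi_fintype, e.finrank_eq]
    simpa [mul_comm] using hlt
  obtain ⟨r, hr, hr0⟩ := (Submodule.ne_bot_iff _).1 hker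
  have hdeg : ∀ i, (r i : k[X]).natDegree ≤ B := fun i => by
    have := mem_degreeLT.1 (r i).2
    by_cases h0 : (r i : k[X]) = 0
    · simp [h0]
    · rw [← natDegree_lt_iff_degree_lt h0] at this; omega
  refine ⟨fun i => r i, fun h => hr0 ?_, hdeg, ?_⟩
  · funext i; exact Subtype.ext (congrFun h i)
  · rw [← hΨ]
    ext n
    by_cases hn : n < N
    · exact congrFun (LinearMap.mem_ker.1 hr) ⟨n, hn⟩
    · rw [coeff_zero]
      apply coeff_eq_zero_of_natDegree_lt
      refine lt_of_lt_of_le ?_ (not_lt.1 hn)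
      by_cases hN : N = 0
      · subst hN
        have : IsEmpty ι := ⟨fun i => by have := hV i; omega⟩
        simp at hlt
      rw [hΨ]
      refine (natDegree_sum_le_of_forall_le (n := N - 1) _ _ fun i _ => ?_).trans_lt (by omega)
      have h1 : (aeval y (r i : k[X])).natDegree ≤ B := by
        rw [aeval_def, eval₂_eq_sum_range]
        refine natDegree_sum_le_of_forall_le _ _ fun j hj => ?_
        rw [Finset.mem_range] at hj
        rw [Polynomial.algebraMap_apply]
        refine (natDegree_C_mul_le _ _).trans (natDegree_pow_le.trans ?_)
        have := hdeg i
        calc j * y.natDegree ≤ j * 1 := Nat.mul_le_mul_left _ hy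
          _ ≤ B := by omega
      have := natDegree_mul_le (p := V i) (q := aeval y (r i : k[X]))
      have := hV i
      omega

/-- The polynomial `U` of bounded degree with `F ^ l * (F + G) ^ n = F ^ n * U` as soon as
`G ^ l = 0`. -/
noncomputable def truncatedBinomial {R : Type*} [CommRing R] (F G : R) (l n : ℕ) : R :=
  ∑ i ∈ Finset.range l, (n.choose i : R) * F ^ (l - i) * G ^ i

theorem pow_mul_add_pow_eq_truncatedBinomial {R : Type*} [CommRing R] (F G : R) (l n : ℕ)
    (hG : G ^ l = 0) : F ^ l * (F + G) ^ n = F ^ n * truncatedBinomial F G l n := by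
  have h1 : (F + G) ^ n = ∑ i ∈ Finset.range (n + 1 + l), F ^ (n - i) * G ^ i * n.choose i := by
    rw [add_comm F G, add_pow, Finset.sum_range_add _ (n + 1) l,
      Finset.sum_congr rfl (fun i _ => by rw [mul_comm (G ^ i)] : ∀ i ∈ Finset.range (n + 1),
        G ^ i * F ^ (n - i) * (n.choose i : R) = F ^ (n - i) * G ^ i * n.choose i)]
    rw [left_eq_add]
    refine Finset.sum_eq_zero fun i _ => ?_
    rw [Nat.choose_eq_zero_of_lt (by omega)]; simp
  have h2 : (F + G) ^ n = ∑ i ∈ Finset.range l, F ^ (n - i) * G ^ i * n.choose i := by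
    rw [h1, add_comm (n + 1), Finset.sum_range_add _ l, add_eq_left]
    refine Finset.sum_eq_zero fun i _ => ?_
    rw [pow_add G, hG]; simp
  rw [h2, truncatedBinomial, Finset.mul_sum, Finset.mul_sum]
  refine Finset.sum_congr rfl fun i hi => ?_
  rw [Finset.mem_range] at hi
  by_cases hin : i ≤ n
  · have : F ^ l * F ^ (n - i) = F ^ n * F ^ (l - i) := by
      rw [← pow_add, ← pow_add]; congr 1; omega
    linear_combination (G ^ i * (n.choose i : R)) * this
  · rw [Nat.choose_eq_zero_of_lt (by omega)]; simp

theorem natDegree_truncatedBinomial_le {A : Type*} [CommRing A] {F G : A[X]} {m : ℕ}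
    (hF : F.natDegree ≤ m) (hG : G.natDegree ≤ m) (l n : ℕ) :
    (truncatedBinomial F G l n).natDegree ≤ l * m := by
  refine natDegree_sum_le_of_forall_le _ _ fun i hi => ?_
  rw [Finset.mem_range] at hi
  rw [mul_assoc, ← C_eq_natCast]
  refine (natDegree_C_mul_le _ _).trans (natDegree_mul_le.trans ?_)
  calc _ ≤ (l - i) * m + i * m := add_le_add
        (natDegree_pow_le.trans (Nat.mul_le_mul_left _ hF))
        (natDegree_pow_le.trans (Nat.mul_le_mul_left _ hG))
    _ = l * m := by rw [← add_mul]; congr 1; omega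

theorem stepanov_card_mul_le {k : Type*} [Field k] [Fintype k] [DecidableEq k] {D : ℕ} (hD : 0 < D)
    (hdvd : D ∣ Fintype.card k - 1) {f : k[X]} (hf : f.Monic)
    (H : ∀ s, s.Prime → s ∣ D → ∃ α, ¬ s ∣ f.rootMultiplicity α) {B J l : ℕ}
    (hB : D * (B + f.natDegree) < Fintype.card k) (hl : l ≤ Fintype.card k)
    (hlin : l * (B + J + l * f.natDegree) < D * J * (B + 1)) {a : k} (ha : a ≠ 0) :
    l * (Finset.univ.filter fun x : k => f.eval x ^ ((Fintype.card k - 1) / D) = a).card ≤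
      B + Fintype.card k * J + Fintype.card k * f.natDegree := by
  set Q := Fintype.card k with hQ
  have hQ1 : 1 < Q := Fintype.one_lt_card
  set c := (Q - 1) / D with hc
  have hcD : c * D = Q - 1 := Nat.div_mul_cancel hdvd
  have hc0 : c ≠ 0 := by rintro h0; rw [h0] at hcD; omega
  have hX0 : (X ^ l : k[X]) ≠ 0 := pow_ne_zero _ X_ne_zero
  let A := AdjoinRoot (X ^ l : k[X])
  let τ : A := AdjoinRoot.root (X ^ l)
  have hτ : τ ^ l = 0 := by
    have := AdjoinRoot.eval₂_root (X ^ l : k[X])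
    simpa using this
  have hfin : Module.finrank k A = l := by
    rw [(AdjoinRoot.powerBasis hX0).finrank, AdjoinRoot.powerBasis_dim, natDegree_X_pow]
  have : Module.Finite k A := (AdjoinRoot.powerBasis hX0).finite
  let y : A[X] := X + C τ
  let F : A[X] := f.map (algebraMap k A)
  let F' : A[X] := aeval y f
  have hy : y.natDegree ≤ 1 := (natDegree_add_le _ _).trans (max_le natDegree_X_le (by simp))
  have hFd : F.natDegree ≤ f.natDegree := natDegree_map_le
  have hF'd : F'.natDegree ≤ f.natDegree := by
    simp only [F', aeval_def, eval₂_eq_sum_range]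
    refine natDegree_sum_le_of_forall_le _ _ fun j hj => ?_
    rw [Finset.mem_range] at hj
    rw [Polynomial.algebraMap_apply]
    refine (natDegree_C_mul_le _ _).trans (natDegree_pow_le.trans ?_)
    calc j * y.natDegree ≤ j * 1 := Nat.mul_le_mul_left _ hy
      _ ≤ f.natDegree := by omega
  have hG : (F' - F) ^ l = 0 := by
    have h1 : F = aeval (X : A[X]) f := rfl
    have h2 : (y - X : A[X]) ∣ F' - F := by
      rw [h1]
      simp only [F', aeval_def, ← eval_map]
      exact sub_dvd_eval_sub _ _ _
    have h3 : (y - X) ^ l ∣ (F' - F) ^ l := pow_dvd_pow_of_dvd h2 l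
    rw [show y - X = C τ by simp [y], ← C_pow, hτ, C_0] at h3
    exact zero_dvd_iff.1 h3
  obtain ⟨r, hr0, hrB, hr⟩ := exists_ne_zero_sum_mul_aeval_eq_zero (k := k) (ι := Fin D × Fin J)
    (fun ij => C (algebraMap k A (a ^ (ij.1 : ℕ))) * X ^ (ij.2 : ℕ) *
      truncatedBinomial F (F' - F) l (c * ij.1)) y (B := B) (N := B + J + l * f.natDegree) hy
    (fun ij => by
      have h1 := natDegree_truncatedBinomial_le (G := F' - F) hFd
        ((natDegree_sub_le _ _).trans (max_le hF'd hFd)) l (c * ij.1)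
      have h2 := natDegree_C_mul_X_pow_le (algebraMap k A (a ^ (ij.1 : ℕ))) (ij.2 : ℕ)
      have h3 := natDegree_mul_le (p := C (algebraMap k A (a ^ (ij.1 : ℕ))) * X ^ (ij.2 : ℕ))
        (q := truncatedBinomial F (F' - F) l (c * ij.1))
      have h4 := ij.2.2
      omega) (by simpa [hfin] using hlin)
  let R : k[X] := ∑ i : Fin D, (∑ j : Fin J, r (i, j) * X ^ (Q * (j : ℕ))) * (f ^ c) ^ (i : ℕ)
  have hR0 : R ≠ 0 := by
    intro h0
    have := stepanov_linearIndependent hD hdvd hf H hB (r := fun i j => r (i, j))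
      (fun i j => hrB (i, j)) h0
    apply hr0
    funext ij
    exact congrFun (congrFun this ij.1) ij.2
  have hRd : R.natDegree ≤ B + Q * J + Q * f.natDegree := by
    refine natDegree_sum_le_of_forall_le _ _ fun i _ => ?_
    refine natDegree_mul_le.trans (add_le_add (natDegree_sum_le_of_forall_le _ _ fun j _ => ?_) ?_)
    · refine natDegree_mul_le.trans (add_le_add (hrB _) ?_)
      rw [natDegree_X_pow]
      exact Nat.mul_le_mul_left _ j.2.le
    · rw [← pow_mul, hf.natDegree_pow]
      refine Nat.mul_le_mul_right _ ?_
      calc c * i ≤ c * D := Nat.mul_le_mul_left _ i.2.le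
        _ ≤ Q := by omega
  have hdiv : ∀ x₀ : k, f.eval x₀ ^ c = a → (X - C x₀) ^ l ∣ R := by
    intro x₀ hx
    rw [X_sub_C_pow_dvd_iff, ← AdjoinRoot.mk_eq_zero, ← AdjoinRoot.aeval_eq, aeval_comp]
    set ξ := algebraMap k A x₀ with hξ
    have hξτ : (aeval (AdjoinRoot.root (X ^ l : k[X])) (X + C x₀) : A) = ξ + τ := by
      simp [ξ, τ, add_comm, A]
    rw [hξτ]
    have hpowQ : (ξ + τ) ^ Q = ξ := by
      have h1 := map_add (FiniteField.frobeniusAlgHom k A) ξ τ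
      simp only [FiniteField.coe_frobeniusAlgHom] at h1
      rw [h1, hξ, ← map_pow, FiniteField.pow_card, show τ ^ Fintype.card k = 0 from
        pow_eq_zero_of_le hl hτ, add_zero]
    have hyE : eval ξ y = ξ + τ := by simp [y]
    have hae : ∀ p : k[X], eval ξ (aeval y p) = aeval (ξ + τ) p := fun p => by
      rw [← hyE, aeval_def, aeval_def, ← coe_evalRingHom, hom_eval₂]
      congr 1
      ext x; simp
    set φ := algebraMap k A (f.eval x₀) with hφ
    have hFE : eval ξ F = φ := by
      simp [F, hξ, eval_map_algebraMap, aeval_algebraMap_apply, hφ]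
    have hφu : IsUnit φ := by
      have : f.eval x₀ ≠ 0 := by
        rintro h0; rw [h0, zero_pow hc0] at hx; exact ha hx.symm
      exact (IsUnit.mk0 _ this).map (algebraMap k A)
    have hkey : ∀ i : ℕ, φ ^ l * aeval (ξ + τ) f ^ (c * i) =
        algebraMap k A (a ^ i) * eval ξ (truncatedBinomial F (F' - F) l (c * i)) := fun i => by
      have := congrArg (eval ξ) (pow_mul_add_pow_eq_truncatedBinomial F (F' - F) l (c * i) hG)
      rw [add_sub_cancel, eval_mul, eval_mul, eval_pow, eval_pow, eval_pow, hFE, hae] at this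
      rw [this, ← hx, pow_mul, map_pow, map_pow]
    apply (hφu.pow l).mul_right_cancel
    rw [zero_mul]
    have hr' := congrArg (eval ξ) hr
    rw [eval_finsetSum, eval_zero, Fintype.sum_prod_type] at hr'
    rw [← hr']
    simp only [R, map_sum, map_mul, map_pow, aeval_X, Finset.sum_mul]
    rw [Finset.sum_mul]
    refine Finset.sum_congr rfl fun i _ => ?_
    rw [Finset.sum_mul]
    refine Finset.sum_congr rfl fun j _ => ?_
    have hk := hkey i
    rw [map_pow] at hk
    simp only [eval_mul, eval_C, eval_pow, eval_X, hae]
    rw [pow_mul (ξ + τ), hpowQ, ← pow_mul]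
    linear_combination (aeval (ξ + τ) (r (i, j)) * ξ ^ (j : ℕ)) * hk
  have hprod : ∏ x ∈ Finset.univ.filter (fun x : k => f.eval x ^ c = a), (X - C x) ^ l ∣ R := by
    refine Finset.prod_dvd_of_coprime (fun x _ y _ hxy => ?_) fun x hx => hdiv x (by simpa using hx)
    exact (pairwise_coprime_X_sub_C Function.injective_id hxy).pow
  refine le_trans ?_ hRd
  refine le_trans (le_of_eq ?_) (natDegree_le_of_dvd hprod hR0)
  rw [natDegree_prod_of_monic _ _ fun x _ => (monic_X_sub_C x).pow l]
  simp [mul_comm]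

theorem stepanov_mul_card_le {k : Type*} [Field k] [Fintype k] [DecidableEq k] {D ℓ : ℕ}
    (hD : 0 < D) (hℓ : Fintype.card k = ℓ ^ 2) (hdvd : D ∣ ℓ - 1) {f : k[X]} (hf : f.Monic)
    (H : ∀ s, s.Prime → s ∣ D → ∃ α, ¬ s ∣ f.rootMultiplicity α) {a : k} (ha : a ≠ 0) :
    D * (Finset.univ.filter fun x : k => f.eval x ^ ((Fintype.card k - 1) / D) = a).card ≤
      ℓ ^ 2 + 4 * D * (D * (f.natDegree + 3) * (1 + D * f.natDegree)) * ℓ := by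
  set m := f.natDegree with hm
  set K := D * (m + 3) * (1 + D * m) with hK
  have hN : (Finset.univ.filter fun x : k => f.eval x ^ ((Fintype.card k - 1) / D) = a).card ≤
    ℓ ^ 2 := by rw [← hℓ]; exact Finset.card_le_univ _
  have hQ1 : 1 < Fintype.card k := Fintype.one_lt_card
  have hℓ1 : 1 < ℓ := by
    by_contra h
    have : ℓ ^ 2 ≤ 1 ^ 2 := Nat.pow_le_pow_left (by omega) 2
    omega
  have hDK : D * (m + 3) ≤ K := Nat.le_mul_of_pos_right _ (by positivity)
  have hDK' : D ≤ K := le_trans (Nat.le_mul_of_pos_right _ (by omega)) hDK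
  rcases lt_or_ge ℓ (2 * K) with hlt | hge
  · calc _ ≤ D * ℓ ^ 2 := Nat.mul_le_mul_left _ hN
      _ ≤ D * (2 * K * ℓ) := by rw [sq]; gcongr
      _ ≤ _ := by nlinarith [Nat.zero_le (D * K * ℓ)]
  obtain ⟨ℓ', rfl⟩ : ∃ u, ℓ = u + 1 := ⟨ℓ - 1, by omega⟩
  obtain ⟨u, hu⟩ := hdvd
  have hu : ℓ' = D * u := by omega
  have hB0 : D * (u * (ℓ' + 2)) + 1 = (ℓ' + 1) ^ 2 := by rw [← mul_assoc, ← hu]; ring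
  have hmu : m ≤ u * (ℓ' + 2) := by
    by_contra h
    have := Nat.mul_le_mul_left D (not_le.1 h).le
    nlinarith [Nat.le_mul_of_pos_right (D * m) (show 0 < m + 3 by omega)]
  obtain ⟨B, hB⟩ := Nat.exists_eq_add_of_le' hmu
  have hdvd : D ∣ Fintype.card k - 1 := ⟨u * (ℓ' + 2), by omega⟩
  have hDB : D * B + D * m + 1 = (ℓ' + 1) ^ 2 := by rw [← hB0, hB]; ring
  have hlin : (ℓ' + 1) * (B + (u + (m + 3)) + (ℓ' + 1) * m) < D * (u + (m + 3)) * (B + 1) := by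
    refine Nat.lt_of_mul_lt_mul_left (a := D) ?_
    have hV : 2 * (D * (m + 3)) ≤ ℓ' + 1 := by omega
    have hV1 : 2 * (D * (m + 3) * (1 + D * m)) ≤ ℓ' + 1 := hge
    have h1 : 1 ≤ D := hD
    zify at *
    generalize hLL : (ℓ' : ℤ) + 1 = L at *
    generalize hVV : (D : ℤ) * (m + 3) = V at *
    have e1 : (D : ℤ) * (L * (B + (u + (m + 3)) + L * m)) =
      L * (D * B + D * u + V + D * m * L) := by rw [← hVV]; ring
    have e2 : (D : ℤ) * (D * (u + (m + 3)) * (B + 1)) = (D * u + V) * (D * B + D) := by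
      rw [← hVV]; ring
    have e3 : (D : ℤ) * B = L ^ 2 - 1 - D * m := by linarith
    have e4 : (D : ℤ) * u = L - 1 := by linarith
    rw [e1, e2, e3, e4]
    have e5 : (D : ℤ) * m = V - 3 * D := by rw [← hVV]; ring
    have hW : (0 : ℤ) ≤ D * m := by positivity
    have hL : 1 ≤ L := by omega
    have e6 : (L - 1 + V) * (L ^ 2 - 1 - D * m + D) -
        L * (L ^ 2 - 1 - D * m + (L - 1) + V + D * m * L) =
        L ^ 2 * (3 * D - 2) + L * (D + 1 - V) - (V - 1) * (1 + D * m - D) := by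
      rw [e5]; ring
    have e7 : (V - 1) * (1 + D * m - D) ≤ V * (1 + D * m) := by nlinarith
    have e8 : L ^ 2 * 1 ≤ L ^ 2 * (3 * D - 2) :=
      mul_le_mul_of_nonneg_left (by linarith) (by positivity)
    have e9 : L * (2 * V) ≤ L * L := mul_le_mul_of_nonneg_left hV (by linarith)
    have e10 : L * 1 ≤ L * L := mul_le_mul_of_nonneg_left hL (by linarith)
    have e11 : 0 < L * (D + 1) := by positivity
    linarith
  have key := stepanov_card_mul_le hD hdvd hf H (B := B) (J := u + (m + 3)) (l := ℓ' + 1)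
    (by rw [← hm, ← hB]; omega) (by rw [hℓ]; nlinarith) hlin ha
  refine le_of_mul_le_mul_left ?_ (show 0 < ℓ' + 1 by omega)
  generalize Finset.card _ = N at key ⊢
  rw [hℓ, ← hm] at key
  have hVK : D * (m + 3) + D * m ≤ 4 * D * K := by nlinarith
  have hDu : D * u ≤ ℓ' + 1 - 1 := by omega
  calc (ℓ' + 1) * (D * N) = D * ((ℓ' + 1) * N) := by ring
    _ ≤ D * (B + (ℓ' + 1) ^ 2 * (u + (m + 3)) + (ℓ' + 1) ^ 2 * m) :=
        Nat.mul_le_mul_left _ key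
    _ = D * B + (ℓ' + 1) ^ 2 * (D * u + (D * (m + 3) + D * m)) := by ring
    _ ≤ (ℓ' + 1) ^ 2 * 1 + (ℓ' + 1) ^ 2 * (ℓ' + 4 * D * K) := by
      rw [mul_one]
      exact add_le_add (by omega) (Nat.mul_le_mul_left _ (by omega))
    _ = _ := by ring

theorem MulChar.apply_pow_eq_one_iff_orderOf_dvd {F R : Type*} [Field F] [Finite F] [CommRing R]
    (χ : MulChar F R) {g : Fˣ} (hg : ∀ x, x ∈ Subgroup.zpowers g) (n : ℕ) :
    χ (g ^ n : Fˣ) = 1 ↔ orderOf χ ∣ n := by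
  rw [orderOf_dvd_iff_pow_eq_one, MulChar.eq_iff hg, MulChar.pow_apply_coe, MulChar.one_apply_coe,
    Units.val_pow_eq_pow_val, map_pow]

theorem MulChar.apply_eq_one_iff_exists_pow_eq {F R : Type*} [Field F] [Finite F] [CommRing R]
    (χ : MulChar F R) {t : F} (ht : t ≠ 0) : χ t = 1 ↔ ∃ y, y ^ orderOf χ = t := by
  refine ⟨fun h => ?_, ?_⟩
  · obtain ⟨g, hg⟩ := IsCyclic.exists_generator (α := Fˣ)
    obtain ⟨j, hj⟩ := (mem_powers_iff_mem_zpowers (x := g)).2 (hg (Units.mk0 t ht))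
    have htj : t = (g ^ j : Fˣ) := by rw [show g ^ j = Units.mk0 t ht from hj, Units.val_mk0]
    rw [htj, χ.apply_pow_eq_one_iff_orderOf_dvd hg] at h
    obtain ⟨c, rfl⟩ := h
    exact ⟨(g ^ c : Fˣ), by rw [htj, ← Units.val_pow_eq_pow_val, ← pow_mul, mul_comm]⟩
  · rintro ⟨y, rfl⟩
    have hpos : orderOf χ ≠ 0 := χ.orderOf_pos.ne'
    have hy : IsUnit y := ((pow_ne_zero_iff hpos).1 ht).isUnit
    rw [map_pow, ← MulChar.pow_apply' _ hpos, pow_orderOf_eq_one, MulChar.one_apply hy]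

theorem MulChar.apply_eq_one_iff_pow_eq_one {F R : Type*} [Field F] [Fintype F] [CommRing R]
    (χ : MulChar F R) {t : F} (ht : t ≠ 0) :
    χ t = 1 ↔ t ^ ((Fintype.card F - 1) / orderOf χ) = 1 := by
  obtain ⟨g, hg⟩ := IsCyclic.exists_generator (α := Fˣ)
  have hpow := χ.apply_pow_eq_one_iff_orderOf_dvd hg
  have hcard : orderOf g = Fintype.card F - 1 := by
    rw [orderOf_eq_card_of_forall_mem_zpowers hg, Nat.card_units, Nat.card_eq_fintype_card]
  have hdvd : orderOf χ ∣ Fintype.card F - 1 := by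
    rw [← hpow, ← hcard, pow_orderOf_eq_one, Units.val_one, map_one]
  obtain ⟨c, hc⟩ := hdvd
  have h1 : 1 < Fintype.card F := Fintype.one_lt_card
  have hpos : 0 < orderOf χ := Nat.pos_of_ne_zero fun h => by rw [h] at hc; omega
  have hcpos : 0 < c := Nat.pos_of_ne_zero fun h => by rw [h] at hc; omega
  have hmem : Units.mk0 t ht ∈ Submonoid.powers g :=
    (mem_powers_iff_mem_zpowers (x := g)).2 (hg _)
  obtain ⟨j, hj⟩ := hmem
  have htj : t = (g ^ j : Fˣ) := by rw [show g ^ j = Units.mk0 t ht from hj, Units.val_mk0]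
  rw [hc, Nat.mul_div_cancel_left _ hpos, htj, hpow, ← Units.val_pow_eq_pow_val, ← pow_mul,
    Units.val_eq_one, ← orderOf_dvd_iff_pow_eq_one, hcard, hc, Nat.mul_dvd_mul_iff_right hcpos]

theorem norm_sum_mulChar_algebraNorm_le {F E : Type*} [Field F] [Fintype F] [Field E] [Fintype E]
    [Algebra F E] (χ : MulChar F ℂ) (hχ : χ ≠ 1) {ℓ : ℕ} (hℓ : Fintype.card E = ℓ ^ 2)
    (hdvd : orderOf χ ∣ ℓ - 1) {f : E[X]} (hf : f.Monic)
    (H : ∀ s, s.Prime → s ∣ orderOf χ → ∃ α, ¬ s ∣ f.rootMultiplicity α) :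
    ‖∑ x : E, χ (Algebra.norm F (f.eval x))‖ ≤ f.natDegree +
      4 * orderOf χ * (orderOf χ * (f.natDegree + 3) * (1 + orderOf χ * f.natDegree)) * ℓ := by
  classical
  set D := orderOf χ with hDdef
  have hD0 : 0 < D := χ.orderOf_pos
  have hD1 : 1 < D := by
    refine lt_of_le_of_ne hD0 fun h => hχ ?_
    exact orderOf_eq_one_iff.1 h.symm
  have : NeZero D := ⟨hD0.ne'⟩
  have hζ := Complex.isPrimitiveRoot_exp D hD0.ne'
  set ζ := Complex.exp (2 * Real.pi * Complex.I / D)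
  set m := f.natDegree
  let C := 4 * D * (D * (m + 3) * (1 + D * m))
  let N : ℕ → Finset E := fun i =>
    Finset.univ.filter fun x => χ (Algebra.norm F (f.eval x)) = ζ ^ i
  have hz : ∀ x, χ (Algebra.norm F (f.eval x)) = 0 ↔ f.eval x = 0 := fun x => by
    constructor
    · intro h
      by_contra h0
      have : IsUnit (Algebra.norm F (f.eval x)) := by
        rw [isUnit_iff_ne_zero]; exact Algebra.norm_ne_zero_iff.2 h0
      exact (this.map χ).ne_zero h
    · intro h; rw [h, Algebra.norm_zero, χ.map_zero]
  have hE1 : 1 < Fintype.card E := Fintype.one_lt_card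
  have hF1 : 1 < Fintype.card F := Fintype.one_lt_card
  have hFE : Fintype.card F - 1 ∣ Fintype.card E - 1 := by
    rw [Module.card_eq_pow_finrank (K := F) (V := E)]
    exact Nat.sub_one_dvd_pow_sub_one _ _
  have hDF : D ∣ Fintype.card F - 1 := χ.orderOf_dvd_card_sub_one
  have hN : ∀ i, D * (N i).card ≤ ℓ ^ 2 + C * ℓ := by
    intro i
    rcases (N i).eq_empty_or_nonempty with h | ⟨x₀, hx₀⟩
    · simp [h]
    simp only [N, Finset.mem_filter, Finset.mem_univ, true_and] at hx₀
    have hne : ∀ x, χ (Algebra.norm F (f.eval x)) = ζ ^ i → f.eval x ≠ 0 := fun x hx h0 => by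
      rw [(hz x).2 h0] at hx
      exact pow_ne_zero i (hζ.ne_zero hD0.ne') hx.symm
    have h0 := hne x₀ hx₀
    refine le_trans (Nat.mul_le_mul_left _ (Finset.card_le_card ?_))
      (stepanov_mul_card_le hD0 hℓ hdvd hf H
        (a := f.eval x₀ ^ ((Fintype.card E - 1) / D)) (pow_ne_zero _ h0))
    intro x hx
    simp only [N, Finset.mem_filter, Finset.mem_univ, true_and] at hx ⊢
    have h0' := hne x hx
    have h1 : χ (Algebra.norm F (f.eval x / f.eval x₀)) = 1 := by
      refine mul_right_cancel₀ (mt (hz x₀).1 h0) ?_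
      rw [← map_mul, ← map_mul, div_mul_cancel₀ _ h0, hx, hx₀, one_mul]
    rw [χ.apply_eq_one_iff_pow_eq_one (Algebra.norm_ne_zero_iff.2 (div_ne_zero h0' h0))] at h1
    have h2 := congrArg (algebraMap F E) h1
    rw [map_pow, FiniteField.algebraMap_norm_eq_pow, map_one, ← pow_mul,
      Nat.card_eq_fintype_card, Nat.card_eq_fintype_card, Nat.div_mul_div_comm hFE hDF,
      mul_comm, Nat.mul_div_mul_left _ _ (by omega), div_pow,
      div_eq_one_iff_eq (pow_ne_zero _ h0)] at h2
    exact h2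
  have hpow : ∀ x, f.eval x ≠ 0 → ∃ i < D, χ (Algebra.norm F (f.eval x)) = ζ ^ i := fun x hx =>
    MulChar.exists_apply_eq_pow (pow_orderOf_eq_one χ) hζ (Algebra.norm_ne_zero_iff.2 hx)
  have hval : ∑ x, χ (Algebra.norm F (f.eval x)) =
      ∑ i ∈ Finset.range D, ζ ^ i * ((N i).card : ℂ) := by
    simp only [N, Finset.card_filter, Nat.cast_sum, Finset.mul_sum]
    rw [Finset.sum_comm]
    refine Finset.sum_congr rfl fun x _ => ?_
    by_cases hx : f.eval x = 0
    · rw [(hz x).2 hx, Finset.sum_eq_zero]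
      intro i _
      rw [if_neg fun h => pow_ne_zero i (hζ.ne_zero hD0.ne') h.symm, Nat.cast_zero, mul_zero]
    · obtain ⟨i, hi, hxi⟩ := hpow x hx
      rw [Finset.sum_eq_single_of_mem i (Finset.mem_range.2 hi), if_pos hxi, hxi]
      · simp
      · intro j hj hji
        rw [if_neg fun h => hji (hζ.pow_inj (Finset.mem_range.1 hj) hi (h.symm.trans hxi)),
          Nat.cast_zero, mul_zero]
  have hcount : ℓ ^ 2 ≤ m + ∑ i ∈ Finset.range D, (N i).card := by
    have hsub : (Finset.univ : Finset E) ⊆ f.roots.toFinset ∪ (Finset.range D).biUnion N := by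
      intro x _
      rw [Finset.mem_union]
      by_cases hx : f.eval x = 0
      · exact Or.inl (by simpa [hf.ne_zero] using hx)
      · obtain ⟨i, hi, hxi⟩ := hpow x hx
        exact Or.inr (Finset.mem_biUnion.2 ⟨i, Finset.mem_range.2 hi, by simpa [N] using hxi⟩)
    rw [← hℓ]
    exact (Finset.card_le_card hsub).trans ((Finset.card_union_le _ _).trans
      (add_le_add ((Multiset.toFinset_card_le _).trans (card_roots' f)) Finset.card_biUnion_le))
  have hsum : (D : ℂ) * ∑ x, χ (Algebra.norm F (f.eval x)) =
      ∑ i ∈ Finset.range D, ζ ^ i * (((D * (N i).card : ℕ) : ℂ) - ((ℓ ^ 2 + C * ℓ : ℕ) : ℂ)) := by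
    simp only [mul_sub, Finset.sum_sub_distrib, ← Finset.sum_mul, hζ.geom_sum_eq_zero hD1, hval,
      zero_mul, sub_zero, Finset.mul_sum]
    refine Finset.sum_congr rfl fun i _ => ?_
    push_cast
    ring
  have hDR : (0 : ℝ) < D := by exact_mod_cast hD0
  refine le_of_mul_le_mul_left (a := (D : ℝ)) ?_ hDR
  calc (D : ℝ) * ‖∑ x, χ (Algebra.norm F (f.eval x))‖
      = ‖(D : ℂ) * ∑ x, χ (Algebra.norm F (f.eval x))‖ := by rw [norm_mul, Complex.norm_natCast]
    _ ≤ ∑ i ∈ Finset.range D, (((ℓ ^ 2 + C * ℓ : ℕ) : ℝ) - ((D * (N i).card : ℕ) : ℝ)) := by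
        rw [hsum]
        refine (norm_sum_le _ _).trans (Finset.sum_le_sum fun i _ => ?_)
        rw [norm_mul, norm_pow, hζ.norm'_eq_one hD0.ne', one_pow, one_mul, norm_sub_rev,
          ← Nat.cast_sub (hN i), Complex.norm_natCast, Nat.cast_sub (hN i)]
    _ ≤ _ := by
        have h : (ℓ : ℝ) ^ 2 ≤ m + ∑ i ∈ Finset.range D, ((N i).card : ℝ) := by
          exact_mod_cast hcount
        rw [Finset.sum_sub_distrib, Finset.sum_const, Finset.card_range, nsmul_eq_mul]
        push_cast
        rw [← Finset.mul_sum, ← mul_sub]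
        refine mul_le_mul_of_nonneg_left ?_ hDR.le
        simp only [C]
        push_cast
        linarith

section MonicSums

variable {F : Type*} [Field F] [Fintype F]

theorem finite_setOf_natDegree_le (n : ℕ) : {g : F[X] | g.natDegree ≤ n}.Finite := by
  have e := degreeLTEquiv F (n + 1)
  have : Finite (degreeLT F (n + 1)) := Finite.of_equiv _ e.symm.toEquiv
  refine (Set.toFinite (degreeLT F (n + 1) : Set F[X])).subset fun g hg => ?_
  rw [SetLike.mem_coe, mem_degreeLT]
  exact degree_le_natDegree.trans_lt (by exact_mod_cast Nat.lt_succ_of_le hg)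

variable (F) in
/-- The monic polynomials of degree `n` over a finite field. -/
noncomputable def monicsOfDegree (n : ℕ) : Finset F[X] :=
  ((finite_setOf_natDegree_le (F := F) n).subset
    fun _ (hg : _ ∧ _) => hg.2.le : {g : F[X] | g.Monic ∧ g.natDegree = n}.Finite).toFinset

variable (F) in
/-- The monic irreducible polynomials of degree at most `n` over a finite field. -/
noncomputable def monicIrreduciblesOfDegreeLE (n : ℕ) : Finset F[X] :=
  ((finite_setOf_natDegree_le (F := F) n).subset fun _ (hg : _ ∧ _ ∧ _) => hg.2.2 :
    {g : F[X] | g.Monic ∧ Irreducible g ∧ g.natDegree ≤ n}.Finite).toFinset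

@[simp]
theorem mem_monicsOfDegree {n : ℕ} {g : F[X]} :
    g ∈ monicsOfDegree F n ↔ g.Monic ∧ g.natDegree = n := by
  simp [monicsOfDegree]

@[simp]
theorem mem_monicIrreduciblesOfDegreeLE {n : ℕ} {g : F[X]} :
    g ∈ monicIrreduciblesOfDegreeLE F n ↔ g.Monic ∧ Irreducible g ∧ g.natDegree ≤ n := by
  simp [monicIrreduciblesOfDegreeLE]

open UniqueFactorizationMonoid in
open Classical in
theorem sum_natDegree_mul_card_pow_dvd {n : ℕ} {g : F[X]} (hg : g ∈ monicsOfDegree F n) :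
    ∑ P ∈ monicIrreduciblesOfDegreeLE F n, P.natDegree *
      ((Finset.Icc 1 n).filter fun i => P.natDegree ∣ i ∧ P ^ (i / P.natDegree) ∣ g).card = n := by
  obtain ⟨hm, hn⟩ := mem_monicsOfDegree.1 hg
  have hcard : ∀ P ∈ monicIrreduciblesOfDegreeLE F n,
      ((Finset.Icc 1 n).filter fun i => P.natDegree ∣ i ∧ P ^ (i / P.natDegree) ∣ g).card =
        (normalizedFactors g).count P := by
    intro P hP
    obtain ⟨hPm, hPi, -⟩ := mem_monicIrreduciblesOfDegreeLE.1 hP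
    have hδ : 0 < P.natDegree := hPi.natDegree_pos
    have hdvd : ∀ s, P ^ s ∣ g ↔ s ≤ (normalizedFactors g).count P := fun s => by
      rw [pow_dvd_iff_le_emultiplicity, emultiplicity_eq_count_normalizedFactors hPi hm.ne_zero,
        hPm.normalize_eq_self, Nat.cast_le]
    have himg : ((Finset.Icc 1 n).filter fun i => P.natDegree ∣ i ∧ P ^ (i / P.natDegree) ∣ g) =
        (Finset.Icc 1 ((normalizedFactors g).count P)).image fun s => P.natDegree * s := by
      ext i
      simp only [Finset.mem_filter, Finset.mem_Icc, Finset.mem_image]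
      constructor
      · rintro ⟨⟨h1, -⟩, ⟨s, rfl⟩, h2⟩
        rw [Nat.mul_div_cancel_left _ hδ, hdvd] at h2
        exact ⟨s, ⟨Nat.pos_of_mul_pos_left h1, h2⟩, rfl⟩
      · rintro ⟨s, ⟨h1, h2⟩, rfl⟩
        refine ⟨⟨Nat.mul_pos hδ h1, ?_⟩, dvd_mul_right _ _, ?_⟩
        · have := natDegree_le_of_dvd ((hdvd s).2 h2) hm.ne_zero
          rw [hPm.natDegree_pow, hn] at this
          rwa [mul_comm]
        · rwa [Nat.mul_div_cancel_left _ hδ, hdvd]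
    rw [himg, Finset.card_image_of_injective _ fun a b h => Nat.eq_of_mul_eq_mul_left hδ h]
    simp
  rw [Finset.sum_congr rfl fun P hP => by rw [hcard P hP]]
  have hprod : (normalizedFactors g).prod = g := by
    rw [prod_normalizedFactors_eq hm.ne_zero, hm.normalize_eq_self]
  have hsum : ((normalizedFactors g).map natDegree).sum = n := by
    rw [← natDegree_multiset_prod _ (zero_notMem_normalizedFactors g), hprod, hn]
  refine Eq.trans ?_ hsum
  rw [Finset.sum_multiset_map_count]
  symm
  simp only [smul_eq_mul, mul_comm]
  refine Finset.sum_subset (fun P hP => ?_) fun P _ hP => ?_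
  · rw [Multiset.mem_toFinset] at hP
    have hPi := irreducible_of_normalized_factor P hP
    have hPm : P.Monic := by
      rw [← normalize_normalized_factor P hP]
      exact monic_normalize hPi.ne_zero
    refine mem_monicIrreduciblesOfDegreeLE.2 ⟨hPm, hPi, ?_⟩
    rw [← hn]
    exact natDegree_le_of_dvd (dvd_of_mem_normalizedFactors hP) hm.ne_zero
  · rw [Multiset.mem_toFinset] at hP
    rw [Multiset.count_eq_zero_of_notMem hP, mul_zero]

/-- The coefficients of the `L`-function attached to a completely multiplicative function. -/
noncomputable def monicSum (Λ : F[X] →* ℂ) (n : ℕ) : ℂ :=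
  ∑ g ∈ monicsOfDegree F n, Λ g

open Classical in
/-- The coefficients of the logarithmic derivative of the `L`-function attached to a completely
multiplicative function. -/
noncomputable def primePowerSum (Λ : F[X] →* ℂ) (n : ℕ) : ℂ :=
  ∑ P ∈ (monicIrreduciblesOfDegreeLE F n).filter fun P => P.natDegree ∣ n,
    (P.natDegree : ℂ) * Λ P ^ (n / P.natDegree)

open Classical in
theorem apply_mul_monicSum (Λ : F[X] →* ℂ) {P : F[X]} (hP : P.Monic) {i n : ℕ}
    (hi : P.natDegree = i) (hin : i ≤ n) :
    Λ P * monicSum Λ (n - i) = ∑ g ∈ (monicsOfDegree F n).filter fun g => P ∣ g, Λ g := by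
  rw [monicSum, Finset.mul_sum]
  refine Finset.sum_bij (fun h _ => P * h) (fun h hh => ?_) (fun h _ h' _ e => ?_)
    (fun g hg => ?_) fun h _ => (map_mul Λ P h).symm
  · rw [mem_monicsOfDegree] at hh
    refine Finset.mem_filter.2 ⟨mem_monicsOfDegree.2 ⟨hP.mul hh.1, ?_⟩, dvd_mul_right _ _⟩
    rw [hP.natDegree_mul hh.1]
    omega
  · exact mul_left_cancel₀ hP.ne_zero e
  · obtain ⟨hg, h, rfl⟩ := Finset.mem_filter.1 hg
    rw [mem_monicsOfDegree] at hg
    have hh : h.Monic := hP.of_mul_monic_left hg.1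
    refine ⟨h, mem_monicsOfDegree.2 ⟨hh, ?_⟩, rfl⟩
    have := hg.2
    rw [hP.natDegree_mul hh] at this
    omega

theorem natCast_mul_monicSum (Λ : F[X] →* ℂ) (n : ℕ) :
    (n : ℂ) * monicSum Λ n =
      ∑ i ∈ Finset.Icc 1 n, primePowerSum Λ i * monicSum Λ (n - i) := by
  classical
  have h1 : ∀ i ∈ Finset.Icc 1 n, primePowerSum Λ i * monicSum Λ (n - i) =
      ∑ P ∈ monicIrreduciblesOfDegreeLE F n, ∑ g ∈ monicsOfDegree F n,
        if P.natDegree ∣ i ∧ P ^ (i / P.natDegree) ∣ g then (P.natDegree : ℂ) * Λ g else 0 := by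
    intro i hi
    rw [Finset.mem_Icc] at hi
    have hset : (monicIrreduciblesOfDegreeLE F i).filter (fun P => P.natDegree ∣ i) =
        (monicIrreduciblesOfDegreeLE F n).filter fun P => P.natDegree ∣ i := by
      ext P
      simp only [Finset.mem_filter, mem_monicIrreduciblesOfDegreeLE]
      exact ⟨fun h => ⟨⟨h.1.1, h.1.2.1, h.1.2.2.trans hi.2⟩, h.2⟩,
        fun h => ⟨⟨h.1.1, h.1.2.1, Nat.le_of_dvd hi.1 h.2⟩, h.2⟩⟩
    rw [primePowerSum, hset, Finset.sum_filter, Finset.sum_mul]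
    refine Finset.sum_congr rfl fun P hP => ?_
    rw [mem_monicIrreduciblesOfDegreeLE] at hP
    by_cases hd : P.natDegree ∣ i
    · simp only [hd, true_and, if_true]
      rw [mul_assoc, ← map_pow, apply_mul_monicSum Λ (hP.1.pow _) (i := i)
        (by rw [hP.1.natDegree_pow, Nat.div_mul_cancel hd]) hi.2, Finset.sum_filter, Finset.mul_sum]
      refine Finset.sum_congr rfl fun g _ => ?_
      split_ifs <;> simp
    · simp [hd]
  rw [Finset.sum_congr rfl h1, Finset.sum_comm, Finset.sum_congr rfl fun P _ => Finset.sum_comm,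
    Finset.sum_comm, monicSum, Finset.mul_sum]
  refine Finset.sum_congr rfl fun g hg => ?_
  have h2 := sum_natDegree_mul_card_pow_dvd hg
  conv_lhs => rw [← h2]
  push_cast
  rw [Finset.sum_mul]
  refine Finset.sum_congr rfl fun P _ => ?_
  rw [← Finset.sum_filter, Finset.sum_const, nsmul_eq_mul]
  ring

end MonicSums

theorem FiniteField.card_filter_minpoly_eq {F E : Type*} [Field F] [Finite F] [Field E] [Fintype E]
    [Algebra F E] [DecidableEq F[X]] {P : F[X]} (hm : P.Monic) (hi : Irreducible P)
    (hd : P.natDegree ∣ Module.finrank F E) :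
    (Finset.univ.filter fun x : E => minpoly F x = P).card = P.natDegree := by
  classical
  have := Fintype.ofFinite F
  have hdvd := hi.natDegree_dvd_iff_dvd_X_pow_card_pow_sub_X.1 hd
  rw [Nat.card_eq_fintype_card, ← Module.card_eq_pow_finrank] at hdvd
  have hne : (X ^ Fintype.card E - X : E[X]) ≠ 0 :=
    FiniteField.X_pow_card_sub_X_ne_zero E Fintype.one_lt_card
  have hsplit : (P.map (algebraMap F E)).Splits := by
    have h1 : (X ^ Nat.card E - X : E[X]).Splits := Polynomial.splits_X_pow_nat_card_sub_X
    rw [Nat.card_eq_fintype_card] at h1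
    refine h1.of_dvd hne ?_
    have := Polynomial.map_dvd (algebraMap F E) hdvd
    simpa using this
  rw [← card_rootSet_eq_natDegree (PerfectField.separable_of_irreducible hi) hsplit,
    ← Set.toFinset_card]
  congr 1
  ext x
  simp only [Finset.mem_filter, Finset.mem_univ, true_and, Set.mem_toFinset, mem_rootSet,
    hm.ne_zero, ne_eq, not_false_eq_true]
  constructor
  · rintro rfl; exact minpoly.aeval F x
  · intro h; exact (minpoly.eq_of_irreducible_of_monic hi h hm).symm

theorem sum_apply_minpoly_pow {F E : Type*} [Field F] [Fintype F] [Field E] [Fintype E]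
    [Algebra F E] (Λ : F[X] →* ℂ) :
    ∑ x : E, Λ (minpoly F x) ^ (Module.finrank F E / (minpoly F x).natDegree) =
      primePowerSum Λ (Module.finrank F E) := by
  classical
  have hint : ∀ x : E, IsIntegral F x := fun x => Algebra.IsIntegral.isIntegral x
  rw [primePowerSum, ← Finset.sum_fiberwise_of_maps_to (g := fun x : E => minpoly F x)
    (t := (monicIrreduciblesOfDegreeLE F (Module.finrank F E)).filter
      fun P => P.natDegree ∣ Module.finrank F E)]
  · refine Finset.sum_congr rfl fun P hP => ?_
    simp only [Finset.mem_filter, mem_monicIrreduciblesOfDegreeLE] at hP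
    rw [Finset.sum_congr rfl fun x hx => by rw [(Finset.mem_filter.1 hx).2], Finset.sum_const,
      FiniteField.card_filter_minpoly_eq hP.1.1 hP.1.2.1 hP.2, nsmul_eq_mul]
  · intro x _
    simp only [Finset.mem_filter, mem_monicIrreduciblesOfDegreeLE]
    exact ⟨⟨minpoly.monic (hint x), minpoly.irreducible (hint x), minpoly.natDegree_le x⟩,
      minpoly.degree_dvd (hint x)⟩

theorem Algebra.norm_algebraMap_sub {F E : Type*} [Field F] [Field E] [Algebra F E]
    [FiniteDimensional F E] (a : F) (x : E) : Algebra.norm F (algebraMap F E a - x) =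
      (minpoly F x).eval a ^ (Module.finrank F E / (minpoly F x).natDegree) := by
  have hx : IsIntegral F x := Algebra.IsIntegral.isIntegral x
  set z := algebraMap F E a - x with hz
  have hzi : IsIntegral F z := Algebra.IsIntegral.isIntegral z
  have hmin : minpoly F z = (-1) ^ (minpoly F x).natDegree *
      ((minpoly F x).comp (X + C a)).comp (-X) := by
    rw [hz, show algebraMap F E a - x = -(x - algebraMap F E a) by ring, minpoly.neg,
      minpoly.sub_algebraMap]
    simp [natDegree_comp]
  have hdeg : (minpoly F z).natDegree = (minpoly F x).natDegree := by
    rw [hmin, show (-1 : F[X]) ^ (minpoly F x).natDegree = C ((-1) ^ (minpoly F x).natDegree) by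
      simp, natDegree_C_mul (by simp)]
    simp [natDegree_comp]
  have hcoeff : (minpoly F z).coeff 0 = (-1) ^ (minpoly F x).natDegree * (minpoly F x).eval a := by
    rw [coeff_zero_eq_eval_zero, hmin]
    simp
  rw [Algebra.norm_eq_norm_adjoin, ← IntermediateField.adjoin.powerBasis_gen hzi,
    PowerBasis.norm_gen_eq_coeff_zero_minpoly, IntermediateField.adjoin.powerBasis_gen,
    IntermediateField.minpoly_gen, IntermediateField.adjoin.powerBasis_dim, hcoeff, hdeg,
    ← mul_assoc, ← mul_pow]
  have h1 := Module.finrank_mul_finrank F (IntermediateField.adjoin F {z}) E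
  rw [IntermediateField.adjoin.finrank hzi, hdeg] at h1
  have hpos : 0 < (minpoly F x).natDegree := minpoly.natDegree_pos hx
  rw [← h1, Nat.mul_div_cancel_left _ hpos]
  simp

theorem Polynomial.exists_eq_prod_one_sub_C_mul_X {K : Type*} [Field K] [IsAlgClosed K] (p : K[X])
    (hp : p.coeff 0 = 1) : ∃ s : Multiset K, s.card = p.natDegree ∧
      p = (s.map fun ω => 1 - C ω * X).prod := by
  have hsplit := IsAlgClosed.splits p
  have hp0 : p ≠ 0 := by rintro rfl; simp at hp
  refine ⟨p.roots.map (·⁻¹), by rw [Multiset.card_map, ← hsplit.natDegree_eq_card_roots], ?_⟩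
  have h1 : ∀ z ∈ p.roots, X - C z = C (-z) * (1 - C z⁻¹ * X) := by
    intro z hz
    have hz0 : z ≠ 0 := by
      rintro rfl
      have := (mem_roots hp0).1 hz
      rw [IsRoot, ← coeff_zero_eq_eval_zero, hp] at this
      exact one_ne_zero this
    rw [mul_sub, ← mul_assoc, ← C_mul]
    simp [hz0]
    ring
  have h2 := hsplit.eq_prod_roots
  rw [Multiset.map_congr rfl h1, Multiset.prod_map_mul, ← mul_assoc] at h2
  rw [Multiset.map_map]
  set q := (p.roots.map ((fun ω => 1 - C ω * X) ∘ (·⁻¹))).prod with hq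
  have h3 : p = C (p.leadingCoeff * (p.roots.map fun z => -z).prod) * q := by
    rw [C_mul]
    conv_lhs => rw [h2]
    congr 2
    rw [map_multiset_prod, Multiset.map_map]; rfl
  have h4 : q.coeff 0 = 1 := by
    rw [coeff_zero_eq_eval_zero, hq, eval_multiset_prod, Multiset.map_map]
    simp
  have h5 := congrArg (fun r => coeff r 0) h3
  simp only [coeff_C_mul, hp, h4, mul_one] at h5
  rw [← h5, C_1, one_mul] at h3
  exact h3

open PowerSeries in
theorem PowerSeries.X_mul_derivative_prod_one_sub {K : Type*} [Field K] (s : Multiset K) :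
    (X : K⟦X⟧) * d⁄dX K (s.map fun ω => 1 - C ω * X).prod =
      mk (fun n => if n = 0 then 0 else -(s.map (· ^ n)).sum) *
        (s.map fun ω => 1 - C ω * X).prod := by
  induction s using Multiset.induction with
  | empty =>
    have : (mk fun n => if n = 0 then (0 : K) else -((0 : Multiset K).map (· ^ n)).sum) = 0 := by
      ext n; simp
    rw [this]
    simp
  | cons ω s ih =>
    have h1 : (mk fun n => if n = 0 then (0 : K) else -((ω ::ₘ s).map (· ^ n)).sum) =
        mk (fun n => if n = 0 then 0 else -ω ^ n) +
        mk (fun n => if n = 0 then 0 else -(s.map (· ^ n)).sum) := by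
      ext n
      simp only [coeff_mk, map_add, Multiset.map_cons, Multiset.sum_cons]
      split_ifs <;> ring
    have h2 : mk (fun n => if n = 0 then 0 else -ω ^ n) * (1 - C ω * X) = -(C ω * X) := by
      ext n
      rw [mul_sub, mul_one, ← mul_assoc, map_sub, coeff_mk]
      rcases n with _ | n
      · simp
      · rw [coeff_succ_mul_X, mul_comm _ (C ω), coeff_C_mul, coeff_mk, map_neg, coeff_C_mul,
          coeff_X]
        rcases n with _ | n
        · simp
        · simp [pow_succ]; ring
    have h3 : d⁄dX K (1 - C ω * X) = -C ω := by
      rw [map_sub, Derivation.leibniz]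
      simp [derivative_C]
    rw [Multiset.map_cons, Multiset.prod_cons, Derivation.leibniz, h1, h3]
    simp only [smul_eq_mul]
    linear_combination (1 - C ω * X) * ih - (s.map fun ω => 1 - C ω * X).prod * h2

theorem exists_multiset_eq_neg_sum_pow {A S : ℕ → ℂ} {m : ℕ} (hm : 0 < m) (hA0 : A 0 = 1)
    (hA : ∀ n, m ≤ n → A n = 0)
    (hS : ∀ n : ℕ, (n : ℂ) * A n = ∑ i ∈ Finset.Icc 1 n, S i * A (n - i)) :
    ∃ s : Multiset ℂ, s.card < m ∧ (∀ n, n ≠ 0 → S n = -(s.map (· ^ n)).sum) ∧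
      ∑ n ∈ Finset.range m, A n = (s.map fun ω => 1 - ω).prod := by
  let p : ℂ[X] := ∑ n ∈ Finset.range m, C (A n) * X ^ n
  have hcoeff : ∀ n, p.coeff n = A n := fun n => by
    simp only [p, finsetSum_coeff, coeff_C_mul_X_pow]
    rw [Finset.sum_ite_eq]
    split_ifs with h
    · rfl
    · exact (hA n (by simpa using h)).symm
  obtain ⟨s, hs, hps⟩ := p.exists_eq_prod_one_sub_C_mul_X ((hcoeff 0).trans hA0)
  have hdeg : p.natDegree ≤ m - 1 := natDegree_sum_le_of_forall_le _ _ fun n hn =>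
    (natDegree_C_mul_X_pow_le _ _).trans (by rw [Finset.mem_range] at hn; omega)
  refine ⟨s, by omega, ?_, ?_⟩
  · have hser : (p : PowerSeries ℂ) =
        (s.map fun ω => 1 - PowerSeries.C ω * PowerSeries.X).prod := by
      conv_lhs => rw [hps]
      rw [← coeToPowerSeries.ringHom_apply, map_multiset_prod, Multiset.map_map]
      congr 1
      refine Multiset.map_congr rfl fun ω _ => ?_
      simp
    have h1 := PowerSeries.X_mul_derivative_prod_one_sub s
    rw [← hser] at h1
    have h2 : PowerSeries.X * PowerSeries.derivative ℂ (p : PowerSeries ℂ) =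
        PowerSeries.mk (fun n => if n = 0 then 0 else S n) * (p : PowerSeries ℂ) := by
      have hr : ∀ n, PowerSeries.coeff n (PowerSeries.mk (fun n => if n = 0 then 0 else S n) *
          (p : PowerSeries ℂ)) = n * A n := by
        intro n
        rw [PowerSeries.coeff_mul, Finset.Nat.sum_antidiagonal_eq_sum_range_succ_mk,
          Finset.range_eq_Ico, Finset.sum_eq_sum_Ico_succ_bot (by omega)]
        simp only [PowerSeries.coeff_mk, if_true, zero_mul, zero_add, coeff_coe, hcoeff]
        rw [hS]
        refine Finset.sum_congr rfl fun i hi => ?_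
        rw [if_neg (by rw [Finset.mem_Icc] at hi; omega)]
      ext n
      rw [hr]
      rcases n with _ | n
      · simp
      · rw [mul_comm, PowerSeries.coeff_succ_mul_X, PowerSeries.coeff_derivative, coeff_coe, hcoeff]
        push_cast
        ring
    have hp0 : (p : PowerSeries ℂ) ≠ 0 := by
      intro h
      have := congrArg (PowerSeries.coeff 0) h
      rw [coeff_coe, hcoeff, hA0, map_zero] at this
      exact one_ne_zero this
    have h3 := mul_right_cancel₀ hp0 (h2.symm.trans h1)
    intro n hn
    have := congrArg (PowerSeries.coeff n) h3
    simpa [hn] using this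
  · have : p.eval 1 = ∑ n ∈ Finset.range m, A n := by simp [p, eval_finsetSum]
    rw [← this, hps, eval_multiset_prod, Multiset.map_map]
    simp

theorem norm_le_of_norm_sum_pow_le (s : Multiset ℂ) {C B : ℝ} (hB : 0 < B)
    (h : ∀ n, n ≠ 0 → ‖(s.map (· ^ n)).sum‖ ≤ C * B ^ n) {ω : ℂ} (hω : ω ∈ s) : ‖ω‖ ≤ B := by
  classical
  let Q : ℂ[X] := ∏ z ∈ s.toFinset.erase ω, (X - Polynomial.C z)
  have hQ0 : Q.eval ω ≠ 0 := by
    simp only [Q, eval_prod, eval_sub, eval_X, eval_C]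
    exact Finset.prod_ne_zero_iff.2 fun z hz => sub_ne_zero.2 (Finset.ne_of_mem_erase hz).symm
  have hQ : ∀ z ∈ s, z ≠ ω → Q.eval z = 0 := fun z hz hne => by
    simp only [Q, eval_prod, eval_sub, eval_X, eval_C]
    exact Finset.prod_eq_zero (Finset.mem_erase.2 ⟨hne, Multiset.mem_toFinset.2 hz⟩) (sub_self z)
  have hsum : ∀ n, (s.count ω : ℂ) * (ω ^ n * Q.eval ω) =
      ∑ k ∈ Finset.range (Q.natDegree + 1), Q.coeff k * (s.map (· ^ (n + k))).sum := by
    intro n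
    have h1 : (s.map fun z => z ^ n * Q.eval z).sum = (s.count ω : ℂ) * (ω ^ n * Q.eval ω) := by
      rw [Finset.sum_multiset_map_count, Finset.sum_eq_single ω, nsmul_eq_mul]
      · intro z hz hne
        rw [hQ z (Multiset.mem_toFinset.1 hz) hne, mul_zero, smul_zero]
      · intro h; exact absurd (Multiset.mem_toFinset.2 hω) h
    rw [← h1]
    simp only [← Multiset.sum_map_mul_left]
    rw [← Multiset.sum_map_sum]
    congr 1
    refine Multiset.map_congr rfl fun z _ => ?_
    rw [eval_eq_sum_range, Finset.mul_sum]
    exact Finset.sum_congr rfl fun k _ => by ring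
  set c : ℝ := s.count ω * ‖Q.eval ω‖ with hc
  have hc0 : 0 < c := mul_pos (by exact_mod_cast Multiset.count_pos.2 hω) (norm_pos_iff.2 hQ0)
  set C' : ℝ := ∑ k ∈ Finset.range (Q.natDegree + 1), ‖Q.coeff k‖ * (C * B ^ k) with hC'
  have hbound : ∀ n, n ≠ 0 → c * ‖ω‖ ^ n ≤ C' * B ^ n := by
    intro n hn
    calc c * ‖ω‖ ^ n = ‖(s.count ω : ℂ) * (ω ^ n * Q.eval ω)‖ := by
          rw [norm_mul, norm_mul, norm_pow, Complex.norm_natCast, hc]; ring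
      _ ≤ ∑ k ∈ Finset.range (Q.natDegree + 1), ‖Q.coeff k‖ * (C * B ^ (n + k)) := by
          rw [hsum]
          refine (norm_sum_le _ _).trans (Finset.sum_le_sum fun k _ => ?_)
          rw [norm_mul]
          exact mul_le_mul_of_nonneg_left (h _ (by omega)) (norm_nonneg _)
      _ = C' * B ^ n := by
          rw [hC', Finset.sum_mul]
          exact Finset.sum_congr rfl fun k _ => by ring
  by_contra hlt
  have hr : 1 < ‖ω‖ / B := (one_lt_div hB).2 (not_le.1 hlt)
  obtain ⟨n, hn⟩ := pow_unbounded_of_one_lt (C' / c) hr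
  have h1 : (‖ω‖ / B) ^ (n + 1) ≤ C' / c := by
    rw [div_pow, div_le_div_iff₀ (pow_pos hB _) hc0, mul_comm]
    exact hbound _ (by omega)
  have h2 : (‖ω‖ / B) ^ n ≤ (‖ω‖ / B) ^ (n + 1) := pow_le_pow_right₀ hr.le (by omega)
  linarith

section CharProd

variable {F ι : Type*} [Field F] [Fintype ι]

/-- The completely multiplicative function `g ↦ ∏ i, ψ i (g (a i))` on polynomials. -/
noncomputable def charProd (ψ : ι → MulChar F ℂ) (a : ι → F) : F[X] →* ℂ where
  toFun g := ∏ i, ψ i (g.eval (a i))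
  map_one' := by simp
  map_mul' g h := by simp [Finset.prod_mul_distrib]

theorem charProd_apply (ψ : ι → MulChar F ℂ) (a : ι → F) (g : F[X]) :
    charProd ψ a g = ∏ i, ψ i (g.eval (a i)) := rfl

variable [Fintype F] {ψ : ι → MulChar F ℂ} {a : ι → F}

theorem monicSum_zero (Λ : F[X] →* ℂ) : monicSum Λ 0 = 1 := by
  have : monicsOfDegree F 0 = {1} := by
    ext g
    rw [mem_monicsOfDegree, Finset.mem_singleton]
    exact ⟨fun h => h.1.natDegree_eq_zero.1 h.2, fun h => by simp [h]⟩
  rw [monicSum, this, Finset.sum_singleton, map_one]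

theorem sum_prod_mulChar_eq_zero [DecidableEq ι] [Nonempty ι] (hψ : ∀ i, ψ i ≠ 1) (b : ι → F) :
    ∑ v : ι → F, ∏ i, ψ i (b i + v i) = 0 := by
  rw [← Fintype.piFinset_univ, ← Finset.prod_univ_sum (fun _ => Finset.univ)
    fun i x => ψ i (b i + x)]
  obtain ⟨i⟩ := ‹Nonempty ι›
  refine Finset.prod_eq_zero (Finset.mem_univ i) ?_
  rw [Fintype.sum_equiv (Equiv.addLeft (b i)) _ (ψ i) fun x => by simp]
  exact MulChar.sum_eq_zero_of_ne_one (hψ i)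

theorem monicSum_charProd_eq_zero [Nonempty ι] (hψ : ∀ i, ψ i ≠ 1) (ha : Function.Injective a)
    {n : ℕ} (hn : Fintype.card ι ≤ n) : monicSum (charProd ψ a) n = 0 := by
  classical
  let I : (ι → F) → F[X] := fun v => Lagrange.interpolate Finset.univ a v
  have hIdeg : ∀ v, (I v).degree < Fintype.card ι := fun v =>
    Lagrange.degree_interpolate_lt v ha.injOn
  have hIeval : ∀ v i, (I v).eval (a i) = v i := fun v i =>
    Lagrange.eval_interpolate_at_node v ha.injOn (Finset.mem_univ i)
  have hneg : ∀ v, I (-v) = -I v := fun v => map_neg _ v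
  have hmem : ∀ v, ∀ g ∈ monicsOfDegree F n, g + I v ∈ monicsOfDegree F n := by
    intro v g hg
    rw [mem_monicsOfDegree] at hg ⊢
    have hlt : (I v).degree < g.degree := (hIdeg v).trans_le <| by
      rw [degree_eq_natDegree hg.1.ne_zero, hg.2]
      exact_mod_cast hn
    exact ⟨hg.1.add_of_left hlt, by rw [natDegree_add_eq_left_of_degree_lt hlt, hg.2]⟩
  have hshift : ∀ v, monicSum (charProd ψ a) n =
      ∑ g ∈ monicsOfDegree F n, charProd ψ a (g + I v) := by
    intro v
    refine (Finset.sum_bij' (fun g _ => g + I v) (fun g _ => g + I (-v)) (hmem v) (hmem (-v))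
      (fun g _ => ?_) (fun g _ => ?_) fun g _ => rfl).symm <;> simp [hneg]
  have h1 : (Fintype.card (ι → F) : ℂ) * monicSum (charProd ψ a) n = 0 := by
    rw [← nsmul_eq_mul, ← Finset.card_univ, ← Finset.sum_const,
      Finset.sum_congr rfl fun v _ => hshift v, Finset.sum_comm]
    refine Finset.sum_eq_zero fun g _ => ?_
    simp only [charProd_apply, eval_add, hIeval]
    exact sum_prod_mulChar_eq_zero hψ _
  exact (mul_eq_zero.1 h1).resolve_left (by exact_mod_cast Fintype.card_ne_zero)

theorem sum_monicSum_charProd_eq_zero [Nonempty ι] (hψ : ∀ i, ψ i ≠ 1)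
    (ha : Function.Injective a) (hprod : ∏ i, ψ i = 1) :
    ∑ n ∈ Finset.range (Fintype.card ι), monicSum (charProd ψ a) n = 0 := by
  classical
  let I : (ι → F) → F[X] := fun v => Lagrange.interpolate Finset.univ a v
  have hIdeg : ∀ v, (I v).degree < Fintype.card ι := fun v =>
    Lagrange.degree_interpolate_lt v ha.injOn
  have hIeval : ∀ v i, (I v).eval (a i) = v i := fun v i =>
    Lagrange.eval_interpolate_at_node v ha.injOn (Finset.mem_univ i)
  have hunit : ∀ (c : Fˣ) g, charProd ψ a (C (c : F) * g) = charProd ψ a g := by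
    intro c g
    rw [map_mul, charProd_apply ψ a (C _)]
    simp only [eval_C]
    have := congrArg (fun χ : MulChar F ℂ => χ c) hprod
    simp only [MulChar.one_apply_coe] at this
    rw [show (∏ i, ψ i) (c : F) = ∏ i, ψ i (c : F) by
      induction (Finset.univ : Finset ι) using Finset.induction_on with
      | empty => simp
      | insert i s hi ih => rw [Finset.prod_insert hi, Finset.prod_insert hi, MulChar.mul_apply, ih]]
      at this
    rw [this, one_mul]
  have h0 := sum_prod_mulChar_eq_zero (ψ := ψ) hψ 0
  have h1 : ∑ v : ι → F, ∏ i, ψ i ((0 : ι → F) i + v i) =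
      ∑ cg ∈ (Finset.univ : Finset Fˣ) ×ˢ
        ((Finset.range (Fintype.card ι)).biUnion (monicsOfDegree F)),
        charProd ψ a (C (cg.1 : F) * cg.2) := by
    have hmon : ∀ cg ∈ (Finset.univ : Finset Fˣ) ×ˢ
        ((Finset.range (Fintype.card ι)).biUnion (monicsOfDegree F)),
        cg.2.Monic ∧ cg.2.degree < Fintype.card ι := by
      intro cg h
      simp only [Finset.mem_product, Finset.mem_univ, true_and, Finset.mem_biUnion,
        Finset.mem_range, mem_monicsOfDegree] at h
      obtain ⟨n, hn, hm, hd⟩ := h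
      exact ⟨hm, (natDegree_lt_iff_degree_lt hm.ne_zero).1 (hd ▸ hn)⟩
    symm
    refine Finset.sum_bij_ne_zero (fun cg _ _ i => (C (cg.1 : F) * cg.2).eval (a i))
      (fun _ _ _ => Finset.mem_univ _) ?_ ?_ ?_
    · rintro ⟨c, g⟩ hg - ⟨c', g'⟩ hg' - h
      have hg := hmon _ hg
      have hg' := hmon _ hg'
      have e : C (c : F) * g = C (c' : F) * g' :=
        eq_of_degrees_lt_of_eval_index_eq Finset.univ (v := a) ha.injOn
          ((degree_C_mul c.ne_zero).trans_lt hg.2) ((degree_C_mul c'.ne_zero).trans_lt hg'.2)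
          fun i _ => congrFun h i
      have hc := congrArg leadingCoeff e
      rw [leadingCoeff_mul, leadingCoeff_mul, hg.1.leadingCoeff, hg'.1.leadingCoeff, mul_one,
        mul_one, leadingCoeff_C, leadingCoeff_C] at hc
      obtain rfl := Units.ext hc
      rw [mul_right_inj' (C_ne_zero.2 c.ne_zero)] at e
      rw [e]
    · intro v _ hv
      have hI : I v ≠ 0 := by
        rintro h
        refine hv (Finset.prod_eq_zero (Finset.mem_univ (Classical.arbitrary ι)) ?_)
        rw [Pi.zero_apply, zero_add, ← hIeval v, h, eval_zero, MulChar.map_zero]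
      have hlc := leadingCoeff_ne_zero.2 hI
      have hmul : C (I v).leadingCoeff * (C (I v).leadingCoeff⁻¹ * I v) = I v := by
        rw [← mul_assoc, ← C_mul, mul_inv_cancel₀ hlc, C_1, one_mul]
      refine ⟨⟨Units.mk0 _ hlc, C (I v).leadingCoeff⁻¹ * I v⟩, ?_, ?_, ?_⟩
      · simp only [Finset.mem_product, Finset.mem_univ, true_and, Finset.mem_biUnion,
          Finset.mem_range, mem_monicsOfDegree]
        refine ⟨_, ?_, ?_, rfl⟩
        · rw [natDegree_C_mul (inv_ne_zero hlc)]
          exact (natDegree_lt_iff_degree_lt hI).2 (hIdeg v)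
        · rw [mul_comm]
          exact monic_mul_leadingCoeff_inv hI
      · simpa [hmul, charProd_apply, hIeval] using hv
      · ext i
        simp only [Units.val_mk0, hmul, hIeval]
    · intro cg _ _
      simp [charProd_apply]
  rw [h1, Finset.sum_product] at h0
  simp only [hunit, Finset.sum_const, nsmul_eq_mul] at h0
  rw [Finset.sum_biUnion] at h0
  · exact (mul_eq_zero.1 h0).resolve_left (by simp)
  · intro i _ j _ hij
    refine Finset.disjoint_left.2 fun g hg hg' => hij ?_
    rw [mem_monicsOfDegree] at hg hg'
    exact hg.2.symm.trans hg'.2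

theorem primePowerSum_charProd {E : Type*} [Field E] [Fintype E] [Algebra F E] :
    primePowerSum (charProd ψ a) (Module.finrank F E) =
      ∑ x : E, ∏ i, ψ i (Algebra.norm F (algebraMap F E (a i) - x)) := by
  rw [← sum_apply_minpoly_pow]
  refine Finset.sum_congr rfl fun x _ => ?_
  rw [charProd_apply, ← Finset.prod_pow]
  refine Finset.prod_congr rfl fun i _ => ?_
  rw [Algebra.norm_algebraMap_sub, map_pow]

end CharProd

theorem exists_pow_eq_of_isCyclic {G ι : Type*} [Group G] [Finite G] [IsCyclic G] (ψ : ι → G) :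
    ∃ (g : G) (e : ι → ℕ), (∀ i, ψ i = g ^ e i) ∧
      ∀ s : ℕ, s.Prime → s ∣ orderOf g → ∃ i, ¬ s ∣ e i := by
  obtain ⟨⟨g, hgmem⟩, hg⟩ := IsCyclic.exists_generator (α := Subgroup.closure (Set.range ψ))
  have h1 : ∀ i, ∃ n : ℕ, ψ i = g ^ n := fun i => by
    obtain ⟨n, hn⟩ := (mem_powers_iff_mem_zpowers.2
      (hg ⟨ψ i, Subgroup.subset_closure ⟨i, rfl⟩⟩) : _ ∈ Submonoid.powers _)
    exact ⟨n, (congrArg Subtype.val hn).symm⟩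
  choose e he using h1
  refine ⟨g, e, he, fun s hs hsg => ?_⟩
  by_contra! h
  have h2 : Subgroup.closure (Set.range ψ) ≤ Subgroup.zpowers (g ^ s) := by
    rw [Subgroup.closure_le]
    rintro _ ⟨i, rfl⟩
    obtain ⟨k, hk⟩ := h i
    rw [he i, hk, pow_mul]
    exact Subgroup.npow_mem_zpowers _ _
  have h3 := orderOf_dvd_of_mem_zpowers (h2 hgmem)
  rw [orderOf_pow_of_dvd hs.ne_zero hsg] at h3
  have := Nat.le_of_dvd (Nat.div_pos (Nat.le_of_dvd (orderOf_pos g) hsg) hs.pos) h3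
  exact absurd (Nat.div_lt_self (orderOf_pos g) hs.one_lt) this.not_gt

section Weil

variable {F ι : Type*} [Field F] [Fintype F] [Fintype ι] {ψ : ι → MulChar F ℂ} {a : ι → F}

theorem exists_norm_primePowerSum_charProd_le [Nonempty ι] (hψ : ∀ i, ψ i ≠ 1)
    (ha : Function.Injective a) : ∃ C : ℝ, ∀ n, n ≠ 0 →
      ‖primePowerSum (charProd ψ a) (2 * n)‖ ≤ C * (Fintype.card F : ℝ) ^ n := by
  classical
  have : IsCyclic (MulChar F ℂ) := isCyclic_of_surjective _
    (MulChar.mulEquiv_units F ℂ).some.symm.surjective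
  obtain ⟨χ, e, he, hs⟩ := exists_pow_eq_of_isCyclic ψ
  have he0 : ∀ i, e i ≠ 0 := fun i h => hψ i (by rw [he, h, pow_zero])
  have hχ : χ ≠ 1 := fun h => hψ (Classical.arbitrary ι) (by rw [he, h, one_pow])
  obtain ⟨p, hp⟩ := CharP.exists F
  have : Fact p.Prime := ⟨CharP.char_is_prime F p⟩
  set N := ∑ i, e i
  set D := orderOf χ
  refine ⟨N + 4 * D * (D * (N + 3) * (1 + D * N)), fun n hn => ?_⟩
  have : NeZero (2 * n) := ⟨by positivity⟩
  let E := FiniteField.Extension F p (2 * n)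
  let _ : Fintype E := Fintype.ofFinite E
  have hfin : Module.finrank F E = 2 * n := FiniteField.finrank_extension F p (2 * n)
  have hcard : Fintype.card E = (Fintype.card F ^ n) ^ 2 := by
    rw [Module.card_eq_pow_finrank (K := F), hfin, ← pow_mul, mul_comm]
  let f : E[X] := ∏ i, (X - C (-algebraMap F E (a i))) ^ e i
  have hf : f.Monic := monic_prod_of_monic _ _ fun i _ => (monic_X_sub_C _).pow _
  have hdeg : f.natDegree = N := by
    rw [natDegree_prod_of_monic _ _ fun i _ => (monic_X_sub_C _).pow _]
    simp [N]
  have hroot : ∀ i, f.rootMultiplicity (-algebraMap F E (a i)) = e i := by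
    intro i
    rw [← count_roots, roots_prod _ _ hf.ne_zero]
    simp only [roots_pow, roots_X_sub_C, Multiset.count_bind, Multiset.count_nsmul,
      Multiset.count_singleton]
    change ∑ j, _ = _
    rw [Finset.sum_eq_single i]
    · simp
    · intro j _ hj
      rw [if_neg, mul_zero]
      exact fun h => hj (ha ((algebraMap F E).injective (neg_injective h))).symm
    · simp
  have key := norm_sum_mulChar_algebraNorm_le χ hχ hcard
    ((MulChar.orderOf_dvd_card_sub_one F χ).trans
      (by simpa only [one_pow] using Nat.sub_dvd_pow_sub_pow _ 1 n)) hf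
    fun s hsp hsd => by
      obtain ⟨i, hi⟩ := hs s hsp hsd
      exact ⟨_, (hroot i).symm ▸ hi⟩
  have hsum : primePowerSum (charProd ψ a) (2 * n) =
      ∑ x : E, χ (Algebra.norm F (f.eval x)) := by
    refine ((congrArg _ hfin).symm.trans primePowerSum_charProd).trans ?_
    refine Fintype.sum_equiv (Equiv.neg E) _ _ fun x => ?_
    simp only [f, eval_prod, eval_pow, eval_sub, eval_X, eval_C, map_prod, map_pow]
    refine Finset.prod_congr rfl fun i _ => ?_
    rw [he i, MulChar.pow_apply' _ (he0 i), Equiv.neg_apply, neg_sub_neg]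
  rw [hsum]
  refine key.trans ?_
  rw [hdeg, add_mul]
  push_cast
  gcongr
  exact le_mul_of_one_le_right (by positivity)
    (one_le_pow₀ (by exact_mod_cast Fintype.card_pos))

theorem exists_multiset_norm_le_sqrt [Nonempty ι] (hψ : ∀ i, ψ i ≠ 1)
    (ha : Function.Injective a) : ∃ s : Multiset ℂ, s.card < Fintype.card ι ∧
      (∀ ω ∈ s, ‖ω‖ ≤ √(Fintype.card F)) ∧ ∑ x, ∏ i, ψ i (x + a i) = -s.sum ∧
      (∏ i, ψ i = 1 → 1 ∈ s) := by
  obtain ⟨s, hcard, hS, hA⟩ := exists_multiset_eq_neg_sum_pow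
    (A := monicSum (charProd ψ a)) (S := primePowerSum (charProd ψ a)) Fintype.card_pos
    (monicSum_zero _) (fun n => monicSum_charProd_eq_zero hψ ha) (natCast_mul_monicSum _)
  refine ⟨s, hcard, fun ω hω => ?_, ?_, fun hprod => ?_⟩
  · obtain ⟨C, hC⟩ := exists_norm_primePowerSum_charProd_le hψ ha
    refine Real.le_sqrt_of_sq_le ?_
    rw [← norm_pow]
    refine norm_le_of_norm_sum_pow_le (s.map (· ^ 2)) (C := C)
      (by exact_mod_cast Fintype.card_pos) (fun n hn => ?_) (Multiset.mem_map_of_mem _ hω)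
    rw [← norm_neg]
    refine le_of_eq_of_le ?_ (hC n hn)
    rw [hS _ (mul_ne_zero two_ne_zero hn), Multiset.map_map]
    simp [pow_mul]
  · have h := primePowerSum_charProd (ψ := ψ) (a := a) (E := F)
    rw [Module.finrank_self, hS 1 one_ne_zero] at h
    simp only [pow_one, Multiset.map_id'] at h
    rw [h]
    refine Fintype.sum_equiv (Equiv.neg F) _ _ fun x => ?_
    simp [sub_eq_add_neg, add_comm]
  · rw [sum_monicSum_charProd_eq_zero hψ ha hprod, eq_comm, Multiset.prod_eq_zero_iff,
      Multiset.mem_map] at hA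
    obtain ⟨ω, hω, h⟩ := hA
    rwa [sub_eq_zero.1 h]

/-- A multiset version of the triangle inequality. -/
theorem Multiset.norm_sum_le_card_mul {s : Multiset ℂ} {B : ℝ} (h : ∀ ω ∈ s, ‖ω‖ ≤ B) :
    ‖s.sum‖ ≤ s.card * B := by
  refine (norm_multiset_sum_le s).trans ?_
  refine (Multiset.sum_le_card_nsmul _ B ?_).trans (by simp)
  simpa using h

/-- **Weil's bound** for mixed sums of multiplicative characters at distinct shifts. -/
theorem norm_sum_prod_mulChar_le [Nonempty ι] (hψ : ∀ i, ψ i ≠ 1) (ha : Function.Injective a) :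
    ‖∑ x, ∏ i, ψ i (x + a i)‖ ≤ (Fintype.card ι - 1) * √(Fintype.card F) := by
  obtain ⟨s, hcard, hs, hsum, -⟩ := exists_multiset_norm_le_sqrt hψ ha
  rw [hsum, norm_neg]
  refine (Multiset.norm_sum_le_card_mul hs).trans ?_
  gcongr
  rw [le_sub_iff_add_le]
  exact_mod_cast hcard

theorem norm_sum_prod_mulChar_add_one_le [Nonempty ι] (hψ : ∀ i, ψ i ≠ 1)
    (ha : Function.Injective a) (hprod : ∏ i, ψ i = 1) :
    ‖∑ x, ∏ i, ψ i (x + a i) + 1‖ ≤ (Fintype.card ι - 2) * √(Fintype.card F) := by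
  obtain ⟨s, hcard, hs, hsum, h1⟩ := exists_multiset_norm_le_sqrt hψ ha
  obtain ⟨t, rfl⟩ := Multiset.exists_cons_of_mem (h1 hprod)
  rw [hsum, Multiset.sum_cons, neg_add, neg_add_cancel_comm, norm_neg]
  refine (Multiset.norm_sum_le_card_mul fun ω hω => hs ω (Multiset.mem_cons_of_mem hω)).trans ?_
  gcongr
  rw [le_sub_iff_add_le]
  rw [Multiset.card_cons] at hcard
  exact_mod_cast hcard

end Weil

theorem sum_range_pow_eq_ite {z : ℂ} {d : ℕ} (hz : z ^ d = 1) :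
    ∑ n ∈ Finset.range d, z ^ n = if z = 1 then (d : ℂ) else 0 := by
  split_ifs with h
  · simp [h]
  · rw [geom_sum_eq h, hz, sub_self, zero_div]

open scoped Classical in
theorem MulChar.sum_range_orderOf_pow {F : Type*} [Field F] [Finite F] (χ : MulChar F ℂ) (t : F) :
    ∑ n ∈ Finset.range (orderOf χ), χ t ^ n =
      if t = 0 then 1 else if ∃ y, y ^ orderOf χ = t then (orderOf χ : ℂ) else 0 := by
  have hpos : orderOf χ ≠ 0 := χ.orderOf_pos.ne'
  split_ifs with h h'
  · rw [h, MulChar.map_zero, Finset.sum_eq_single 0 (by simp +contextual) (by simp [χ.orderOf_pos])]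
    simp
  all_goals
    rw [sum_range_pow_eq_ite, if_congr (χ.apply_eq_one_iff_exists_pow_eq h) rfl rfl]
    · simp [h']
    · rw [← MulChar.pow_apply' _ hpos, pow_orderOf_eq_one, MulChar.one_apply (Ne.isUnit h)]

section Counting

variable (ι : Type*) [Fintype ι] [DecidableEq ι] (d : ℕ)

theorem card_piFinset_range_filter_dvd_sum [Nonempty ι] (hd : 0 < d) :
    ((Fintype.piFinset fun _ : ι => Finset.range d).filter fun e => d ∣ ∑ i, e i).card =
      d ^ (Fintype.card ι - 1) := by
  have hζ := Complex.isPrimitiveRoot_exp d hd.ne'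
  set ζ := Complex.exp (2 * Real.pi * Complex.I / d)
  have hd0 : (d : ℂ) ≠ 0 := by exact_mod_cast hd.ne'
  have h1 : ∀ e : ι → ℕ, ∑ k ∈ Finset.range d, ∏ i, (ζ ^ k) ^ e i =
      if d ∣ ∑ i, e i then (d : ℂ) else 0 := fun e => by
    rw [← if_congr (hζ.pow_eq_one_iff_dvd (∑ i, e i)) rfl rfl, ← sum_range_pow_eq_ite
      (by rw [← pow_mul, mul_comm, pow_mul, hζ.pow_eq_one, one_pow])]
    refine Finset.sum_congr rfl fun k _ => ?_
    rw [Finset.prod_pow_eq_pow_sum, ← pow_mul, ← pow_mul, mul_comm]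
  have h2 : ∀ k ∈ Finset.range d, ∑ n ∈ Finset.range d, (ζ ^ k) ^ n =
      if k = 0 then (d : ℂ) else 0 := fun k hk => by
    rw [sum_range_pow_eq_ite (by rw [← pow_mul, mul_comm, pow_mul, hζ.pow_eq_one, one_pow])]
    refine if_congr ?_ rfl rfl
    rw [hζ.pow_eq_one_iff_dvd]
    exact ⟨fun h => Nat.eq_zero_of_dvd_of_lt h (Finset.mem_range.1 hk), fun h => h ▸ dvd_zero d⟩
  have h3 : (d : ℂ) * ((Fintype.piFinset fun _ : ι => Finset.range d).filter
      fun e => d ∣ ∑ i, e i).card = d ^ Fintype.card ι := by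
    calc _ = ∑ e ∈ Fintype.piFinset fun _ : ι => Finset.range d,
          ∑ k ∈ Finset.range d, ∏ i, (ζ ^ k) ^ e i := by
          simp only [h1]
          rw [← Finset.sum_filter, Finset.sum_const, nsmul_eq_mul, mul_comm]
      _ = ∑ k ∈ Finset.range d, (if k = 0 then (d : ℂ) else 0) ^ Fintype.card ι := by
          rw [Finset.sum_comm]
          refine Finset.sum_congr rfl fun k hk => ?_
          rw [← h2 k hk, ← Finset.prod_univ_sum (fun _ => Finset.range d) fun _ n => (ζ ^ k) ^ n,
            Finset.prod_const, Finset.card_univ]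
      _ = _ := by
          rw [Finset.sum_eq_single 0]
          · simp
          · intro k _ hk
            rw [if_neg hk, zero_pow Fintype.card_ne_zero]
          · simp [hd.ne']
  obtain ⟨m, hm⟩ := Nat.exists_eq_succ_of_ne_zero (Fintype.card_ne_zero (α := ι))
  rw [hm, pow_succ'] at h3
  rw [hm, Nat.succ_sub_one]
  exact_mod_cast mul_left_cancel₀ hd0 h3

theorem sum_piFinset_range_card_filter_ne_zero (hd : 0 < d) :
    ∑ e ∈ Fintype.piFinset fun _ : ι => Finset.range d,
      (Finset.univ.filter fun i => e i ≠ 0).card =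
      Fintype.card ι * ((d - 1) * d ^ (Fintype.card ι - 1)) := by
  simp only [Finset.card_filter]
  rw [Finset.sum_comm, Finset.sum_const_nat fun i _ => ?_, Finset.card_univ]
  rw [← Finset.card_filter, Finset.filter_not, Finset.card_sdiff_of_subset (Finset.filter_subset _ _),
    Fintype.card_filter_piFinset_const_eq_of_mem _ _ (Finset.mem_range.2 hd),
    Fintype.card_piFinset, Finset.prod_const, Finset.card_univ, Finset.card_range, Nat.sub_one_mul, ← pow_succ',
    Nat.sub_add_cancel (Fintype.card_pos_iff.2 ⟨i⟩)]

end Counting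

theorem Fintype.prod_pow_subtype_ne_zero {ι M : Type*} [Fintype ι] [CommMonoid M] (g : ι → M)
    (e : ι → ℕ) : ∏ i : {i // e i ≠ 0}, g i ^ e i = ∏ i, g i ^ e i := by
  rw [← Finset.prod_filter_of_ne (p := fun i => e i ≠ 0) fun i _ h h0 => h (by rw [h0, pow_zero]),
    Finset.prod_subtype _ (p := fun i => e i ≠ 0) (by simp)]

section ShiftedPowers

variable {F ι : Type*} [Field F] [Fintype F] [Fintype ι] {a : ι → F}

theorem norm_sum_prod_pow_add_ite_le (χ : MulChar F ℂ) (ha : Function.Injective a) {e : ι → ℕ}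
    (hlt : ∀ i, e i < orderOf χ) (he : e ≠ 0) :
    ‖∑ x, ∏ i, χ (x + a i) ^ e i + if orderOf χ ∣ ∑ i, e i then 1 else 0‖ ≤
      ((Finset.univ.filter fun i => e i ≠ 0).card - 1 -
        if orderOf χ ∣ ∑ i, e i then 1 else 0) * √(Fintype.card F) := by
  have hcard : ((Finset.univ.filter fun i => e i ≠ 0).card : ℝ) = Fintype.card {i // e i ≠ 0} := by
    rw [Fintype.card_subtype]
  obtain ⟨i₀, hi₀⟩ := Function.ne_iff.1 he
  have : Nonempty {i // e i ≠ 0} := ⟨⟨i₀, hi₀⟩⟩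
  let ψ : {i // e i ≠ 0} → MulChar F ℂ := fun i => χ ^ e i
  have hψ : ∀ i, ψ i ≠ 1 := fun i h =>
    (Nat.le_of_dvd (Nat.pos_of_ne_zero i.2) (orderOf_dvd_of_pow_eq_one h)).not_gt (hlt i)
  have hinj : Function.Injective fun i : {i // e i ≠ 0} => a i :=
    ha.comp Subtype.val_injective
  have hsum : ∑ x, ∏ i, χ (x + a i) ^ e i = ∑ x, ∏ i, ψ i (x + a i) := by
    refine Finset.sum_congr rfl fun x _ => ?_
    rw [← Fintype.prod_pow_subtype_ne_zero]
    exact Finset.prod_congr rfl fun i _ => (MulChar.pow_apply' χ i.2 _).symm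
  rw [hcard, hsum]
  split_ifs with h
  · have hprod : ∏ i, ψ i = 1 := by
      rw [Fintype.prod_pow_subtype_ne_zero (fun _ => χ), Finset.prod_pow_eq_pow_sum,
        orderOf_dvd_iff_pow_eq_one.1 h]
    refine (norm_sum_prod_mulChar_add_one_le hψ hinj hprod).trans_eq ?_
    ring
  · simpa using norm_sum_prod_mulChar_le hψ hinj

theorem sum_prod_sum_range_orderOf_pow (χ : MulChar F ℂ) (ha : Function.Injective a) :
    ∑ x, ∏ i, ∑ n ∈ Finset.range (orderOf χ), χ (x + a i) ^ n =
      (orderOf χ : ℂ) ^ Fintype.card ι *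
        Nat.card {x : F // ∀ i, x + a i ≠ 0 ∧ ∃ y : F, y ^ orderOf χ = x + a i} +
      (orderOf χ : ℂ) ^ (Fintype.card ι - 1) *
        Nat.card {x : F // (∃ i, x + a i = 0) ∧ ∀ i, ∃ y : F, y ^ orderOf χ = x + a i} := by
  classical
  simp only [MulChar.sum_range_orderOf_pow, Nat.card_eq_fintype_card, Fintype.card_subtype,
    Finset.card_filter, Nat.cast_sum, Finset.mul_sum]
  rw [← Finset.sum_add_distrib]
  refine Finset.sum_congr rfl fun x _ => ?_
  by_cases h : ∀ i, ∃ y : F, y ^ orderOf χ = x + a i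
  · simp only [h, if_true, and_true, implies_true]
    by_cases h0 : ∃ i, x + a i = 0
    · have h0' := h0
      obtain ⟨i, hi⟩ := h0'
      rw [if_neg fun h' => h' i hi, if_pos h0, ← Finset.mul_prod_erase _ _ (Finset.mem_univ i),
        if_pos hi, Finset.prod_congr rfl fun j hj => if_neg fun hj0 =>
          Finset.ne_of_mem_erase hj (ha (add_left_cancel (hj0.trans hi.symm))),
        Finset.prod_const, Finset.card_erase_of_mem (Finset.mem_univ i), Finset.card_univ]
      simp
    · rw [if_neg h0]
      push Not at h0
      rw [if_pos h0, Finset.prod_congr rfl fun i _ => if_neg (h0 i)]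
      simp
  · rw [if_neg fun h' => h fun i => (h' i).2, if_neg fun h' => h h'.2]
    push Not at h
    obtain ⟨i, hi⟩ := h
    rw [Finset.prod_eq_zero (Finset.mem_univ i)]
    · simp
    · rw [if_neg fun h0 => hi 0 (by rw [h0, zero_pow χ.orderOf_pos.ne']),
        if_neg fun ⟨y, hy⟩ => hi y hy]

theorem norm_card_consecutive_powers_le [Nonempty ι] (χ : MulChar F ℂ)
    (ha : Function.Injective a) {d r : ℕ} (hd : orderOf χ = d) (hr : Fintype.card ι = r + 1) :
    |(d : ℝ) ^ (r + 1) * Nat.card {x : F // ∀ i, x + a i ≠ 0 ∧ ∃ y : F, y ^ d = x + a i} +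
      (d : ℝ) ^ r * Nat.card {x : F // (∃ i, x + a i = 0) ∧ ∀ i, ∃ y : F, y ^ d = x + a i} +
      (d : ℝ) ^ r - (Fintype.card F + 1)| ≤
      ((r + 1) * ((d - 1) * (d : ℝ) ^ r) - (d : ℝ) ^ (r + 1) - (d : ℝ) ^ r + 2) *
        √(Fintype.card F) := by
  classical
  have hpos : 0 < d := hd ▸ χ.orderOf_pos
  let E := Fintype.piFinset fun _ : ι => Finset.range d
  let c : (ι → ℕ) → ℕ := fun e => if d ∣ ∑ i, e i then 1 else 0
  let T : (ι → ℕ) → ℂ := fun e => ∑ x, ∏ i, χ (x + a i) ^ e i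
  have hE0 : (0 : ι → ℕ) ∈ E := by simp [E, hpos]
  have hc : ∑ e ∈ E, c e = d ^ r := by
    rw [← Finset.card_filter, card_piFinset_range_filter_dvd_sum ι d hpos, hr, Nat.add_sub_cancel]
  have hs : ∑ e ∈ E, (Finset.univ.filter fun i => e i ≠ 0).card = (r + 1) * ((d - 1) * d ^ r) := by
    rw [sum_piFinset_range_card_filter_ne_zero ι d hpos, hr, Nat.add_sub_cancel]
  have hEcard : E.card = d ^ (r + 1) := by
    simp [E, hr]
  have hT : ∑ e ∈ E, T e = (d : ℂ) ^ (r + 1) *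
      Nat.card {x : F // ∀ i, x + a i ≠ 0 ∧ ∃ y : F, y ^ d = x + a i} +
      (d : ℂ) ^ r *
        Nat.card {x : F // (∃ i, x + a i = 0) ∧ ∀ i, ∃ y : F, y ^ d = x + a i} := by
    have := sum_prod_sum_range_orderOf_pow χ ha
    rw [hd, hr, Nat.add_sub_cancel] at this
    rw [← this, Finset.sum_comm]
    exact Finset.sum_congr rfl fun x _ => (Finset.prod_univ_sum (fun _ => Finset.range d)
      fun i n => χ (x + a i) ^ n).symm
  have hT0 : T 0 + c 0 = (Fintype.card F : ℂ) + 1 := by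
    simp [T, c]
  have hbound : ∀ e ∈ E.erase 0, ‖T e + c e‖ ≤
      ((Finset.univ.filter fun i => e i ≠ 0).card - 1 - c e) * √(Fintype.card F) := by
    intro e he
    rw [Finset.mem_erase] at he
    have := norm_sum_prod_pow_add_ite_le χ ha (e := e) (fun i => by
      rw [hd]; exact Finset.mem_range.1 (Fintype.mem_piFinset.1 he.2 i)) he.1
    rw [hd] at this
    simpa only [T, c, Nat.cast_ite, Nat.cast_one, Nat.cast_zero] using this
  have hkey := norm_sum_le_of_le _ hbound
  rw [← Finset.sum_mul] at hkey
  have hL : ∑ e ∈ E.erase 0, (T e + c e) = ∑ e ∈ E, T e + (d : ℂ) ^ r - (Fintype.card F + 1) := by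
    rw [← hT0, eq_sub_iff_add_eq, Finset.sum_erase_add _ _ hE0, Finset.sum_add_distrib]
    congr 1
    exact_mod_cast hc
  have hR : ∑ e ∈ E.erase 0, (((Finset.univ.filter fun i => e i ≠ 0).card : ℝ) - 1 - c e) =
      (r + 1) * ((d - 1) * (d : ℝ) ^ r) - (d : ℝ) ^ (r + 1) - (d : ℝ) ^ r + 2 := by
    rw [Finset.sum_erase_eq_sub hE0, Finset.sum_sub_distrib, Finset.sum_sub_distrib,
      ← Nat.cast_sum, ← Nat.cast_sum, hc, hs, Finset.sum_const, hEcard]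
    push_cast [Nat.cast_sub hpos]
    simp [c]
    ring
  rw [hL, hR, hT] at hkey
  rw [← Real.norm_eq_abs, ← Complex.norm_real]
  push_cast
  exact hkey

end ShiftedPowers

end

theorem consecutive_powers_bound (p q : ℕ) (hp : p.Prime) (k : ℕ) (hk : 0 < k) (hq : q = p ^ k)
    (F : Type*) [Field F] [Fintype F] [CharP F p] (hcard : Fintype.card F = q)
    (d : ℕ) (hd : d ∣ q - 1) (r : ℕ) (hr : 0 < r) (hrp : r ≤ p)
    (M M₀ : ℕ)
    (hM : M = Nat.card {ξ : F // ∀ j : Fin r, ξ + (j : ℕ) ≠ 0 ∧ ∃ y : F, y ^ d = ξ + (j : ℕ)})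
    (hM₀ : M₀ = Nat.card {ξ : F // (∃ j : Fin r, ξ + (j : ℕ) = 0) ∧
        ∀ j : Fin r, ∃ y : F, y ^ d = ξ + (j : ℕ)}) :
    |(M : ℝ) + ((M₀ : ℝ) + 1) / d - ((q : ℝ) + 1) / (d : ℝ) ^ r| ≤
      ((r : ℝ) - 1 - ((r : ℝ) + 1) / d + 2 / (d : ℝ) ^ r) * Real.sqrt q := by
  have hq1 : 1 < q := hcard ▸ Fintype.one_lt_card
  have hd0 : 0 < d := Nat.pos_of_ne_zero fun h => by
    rw [h, zero_dvd_iff] at hd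
    omega
  obtain ⟨χ, hχ⟩ := MulChar.exists_mulChar_orderOf F (hcard ▸ hd)
    (Complex.isPrimitiveRoot_exp d hd0.ne')
  obtain ⟨s, rfl⟩ := Nat.exists_eq_succ_of_ne_zero hr.ne'
  have hinj : Function.Injective fun j : Fin (s + 1) => ((j : ℕ) : F) := fun i j hij =>
    Fin.ext (CharP.natCast_injOn_Iio F p (i.2.trans_le hrp) (j.2.trans_le hrp) hij)
  have key := norm_card_consecutive_powers_le χ hinj hχ (Fintype.card_fin _)
  rw [← hM, ← hM₀, hcard] at key
  have hdR : (0 : ℝ) < d := by exact_mod_cast hd0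
  have hpow : (0 : ℝ) < (d : ℝ) ^ (s + 1) := pow_pos hdR _
  refine le_of_mul_le_mul_left ?_ hpow
  rw [← abs_of_pos hpow, ← abs_mul, abs_of_pos hpow]
  refine (congrArg _ ?_).trans_le (key.trans_eq ?_)
  · field_simp
    ring
  · symm
    rw [← mul_assoc]
    refine congrArg (· * √(q : ℝ)) ?_
    push_cast
    field_simp
    ring
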